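/- arXiv:1812.03709 — 3 statements merged into one kernel-verified Lean document; each statement's English description precedes it below -/
import Mathlib

section
/- Define $u2(n)$ by $\sum_{n\geq 0} u2(n)q^n = U2(1;-q)$ where $U2(\zeta;q) = \sum_{n\geq 1} \frac{(-\zeta q^2;q^2)_{n-1}(-\zeta^{-1}q^2;q^2)_{n-1}\, q^{2n}}{(-q;q^2)_n}$. Then $u2(n)$ is odd if and only if $8n-1 = 3^b \ell^2 p^c$ where $p$ is a prime congruent to $5$ or $23$ modulo $24$, $p \nmid \ell$, $b \geq 0$, $\ell \geq 1$, and $c \equiv 1 \pmod 4$. -/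
/-- The series `U2(1;-q) = ∑_{n≥1} (-q²;q²)_{n-1}² q^{2n} / (q;q²)_n`. -/
noncomputable def U2series (q : ℝ) : ℝ :=
  ∑' n : ℕ, (∏ j ∈ Finset.range n, (1 + q ^ 2 * (q ^ 2) ^ j)) ^ 2 * q ^ (2 * (n + 1)) /
    ∏ j ∈ Finset.range (n + 1), (1 - q * (q ^ 2) ^ j)



namespace QS
open Finset

variable {K : Type*} [Field K]

/-- The q-Pochhammer symbol `(x;Q)_n`. -/
def poch (Q x : K) (n : ℕ) : K := ∏ i ∈ range n, (1 - x * Q ^ i)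

lemma poch_zero (Q x : K) : poch Q x 0 = 1 := by simp [poch]

lemma poch_succ (Q x : K) (n : ℕ) : poch Q x (n + 1) = poch Q x n * (1 - x * Q ^ n) := by
  simp [poch, prod_range_succ]

lemma poch_succ' (Q x : K) (n : ℕ) : poch Q x (n + 1) = (1 - x) * poch Q (x * Q) n := by
  simp only [poch, prod_range_succ']
  rw [mul_comm]
  congr 1
  · simp
  · apply prod_congr rfl; intro i _; ring

lemma poch_add (Q x : K) (m n : ℕ) :
    poch Q x (m + n) = poch Q x m * poch Q (x * Q ^ m) n := by
  induction n with
  | zero => simp [poch_zero]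
  | succ n ih => rw [← add_assoc, poch_succ, ih, poch_succ]; ring

lemma poch_ne_zero {Q x : K} (h : ∀ i, x * Q ^ i ≠ 1) (n : ℕ) : poch Q x n ≠ 0 := by
  rw [poch, prod_ne_zero_iff]
  intro i _ h0
  exact h i (sub_eq_zero.mp h0).symm

/-- q-Chu-Vandermonde. -/
lemma chu (Q : K) (hQ : ∀ i, Q * Q ^ i ≠ 1) (d : K) (m : ℕ) :
    ∀ b : K, (∀ i, b * d * Q ^ i ≠ 1) →
    ∑ ij ∈ antidiagonal m, poch Q b ij.1 * (-d) ^ ij.1 * Q ^ (ij.1.choose 2) /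
      (poch Q Q ij.1 * poch Q Q ij.2 * poch Q (b * d) ij.1) =
      poch Q d m / (poch Q Q m * poch Q (b * d) m) := by
  have hP := fun n => poch_ne_zero hQ n
  have hQ' : ∀ i, (1 : K) - Q * Q ^ i ≠ 0 := fun i h => hQ i (sub_eq_zero.mp h).symm
  induction m with
  | zero => intro b hb; simp [poch_zero]
  | succ m ih =>
    intro b hb
    have hb' : ∀ i, b * Q * d * Q ^ i ≠ 1 := by
      intro i; have := hb (i + 1); rwa [show b * Q * d * Q ^ i = b * d * Q ^ (i + 1) by ring]
    have hbd := fun n => poch_ne_zero hb n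
    have hbd' := fun n => poch_ne_zero hb' n
    have h1 := ih b hb
    have h2 := ih (b * Q) hb'
    have hb1 : (1 : K) - b * d ≠ 0 := by
      have := hb 0; simp at this; exact fun h => this (sub_eq_zero.mp h).symm
    have hbm : (1 : K) - b * d * Q ^ m ≠ 0 := by
      have := hb m; exact fun h => this (sub_eq_zero.mp h).symm
    have key : (1 - Q * Q ^ m) * ∑ ij ∈ antidiagonal (m+1), poch Q b ij.1 * (-d) ^ ij.1 * Q ^ (ij.1.choose 2) /
      (poch Q Q ij.1 * poch Q Q ij.2 * poch Q (b * d) ij.1)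
      = (∑ ij ∈ antidiagonal (m+1), (1 - Q ^ ij.2) * (poch Q b ij.1 * (-d) ^ ij.1 * Q ^ (ij.1.choose 2) /
      (poch Q Q ij.1 * poch Q Q ij.2 * poch Q (b * d) ij.1)))
      + ∑ ij ∈ antidiagonal (m+1), (Q ^ ij.2 * (1 - Q ^ ij.1)) * (poch Q b ij.1 * (-d) ^ ij.1 * Q ^ (ij.1.choose 2) /
      (poch Q Q ij.1 * poch Q Q ij.2 * poch Q (b * d) ij.1)) := by
      rw [mul_sum, ← sum_add_distrib]
      apply sum_congr rfl
      rintro ⟨i, j⟩ hij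
      rw [HasAntidiagonal.mem_antidiagonal] at hij
      simp only at hij ⊢
      have : Q * Q ^ m = Q ^ i * Q ^ j := by rw [← pow_add, hij]; ring
      rw [this]; ring
    have k1 : (∑ ij ∈ antidiagonal (m+1), (1 - Q ^ ij.2) * (poch Q b ij.1 * (-d) ^ ij.1 * Q ^ (ij.1.choose 2) /
      (poch Q Q ij.1 * poch Q Q ij.2 * poch Q (b * d) ij.1))) =
      poch Q d m / (poch Q Q m * poch Q (b * d) m) := by
      rw [← h1, Nat.sum_antidiagonal_succ']
      simp only [pow_zero, sub_self, zero_mul, zero_add]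
      apply sum_congr rfl
      rintro ⟨i, j⟩ _
      simp only
      rw [poch_succ Q Q j]
      have := hQ' j; have := hP i; have := hP j; have := hbd i
      field_simp
      ring
    have k2 : ∑ ij ∈ antidiagonal (m+1), (Q ^ ij.2 * (1 - Q ^ ij.1)) * (poch Q b ij.1 * (-d) ^ ij.1 * Q ^ (ij.1.choose 2) /
      (poch Q Q ij.1 * poch Q Q ij.2 * poch Q (b * d) ij.1)) =
      -d * Q ^ m * (1 - b) / (1 - b * d) * (poch Q d m / (poch Q Q m * poch Q (b * Q * d) m)) := by
      rw [← h2, Nat.sum_antidiagonal_succ, mul_sum]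
      simp only [pow_zero, sub_self, mul_zero, zero_mul, zero_add]
      apply sum_congr rfl
      rintro ⟨i, j⟩ hij
      rw [HasAntidiagonal.mem_antidiagonal] at hij
      simp only at hij ⊢
      rw [poch_succ Q Q i, poch_succ' Q b, poch_succ' Q (b * d), ← hij,
        show b * d * Q = b * Q * d by ring]
      have := hQ' i; have := hP i; have := hP j; have := hbd' i
      have hc : (i + 1).choose 2 = i + i.choose 2 := by
        rw [Nat.choose_succ_succ]; simp
      rw [hc]
      field_simp
      ring
    have hQm := hQ' m
    apply mul_left_cancel₀ hQm
    rw [key, k1, k2]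
    have e1 : poch Q (b * Q * d) m = poch Q (b * d) m * (1 - b * d * Q ^ m) / (1 - b * d) := by
      rw [← poch_succ, poch_succ', show b * d * Q = b * Q * d by ring]
      field_simp
    rw [e1, poch_succ Q d, poch_succ Q Q, poch_succ Q (b * d)]
    have := hP m; have := hbd m
    clear key k1 k2 e1 h1 h2 ih
    generalize Q ^ m = u at *
    generalize 1 - Q * u = v at *
    field_simp
    ring

/-- Rogers–Szegő at `q`. -/
lemma rogers (q : K) (hq : ∀ i, q ^ (i + 1) ≠ 1) (N : ℕ) :
    ∑ ij ∈ antidiagonal N, q ^ ij.1 / (poch (q ^ 2) (q ^ 2) ij.1 * poch (q ^ 2) (q ^ 2) ij.2) =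
      1 / poch q q N := by
  have hQ : ∀ i, (1 : K) - q ^ 2 * (q ^ 2) ^ i ≠ 0 := fun i h => by
    apply hq (2 * i + 1); rw [show q ^ (2 * i + 1 + 1) = q ^ 2 * (q ^ 2) ^ i by ring]
    exact (sub_eq_zero.mp h).symm
  have hq' : ∀ i, (1 : K) - q * q ^ i ≠ 0 := fun i h => by
    apply hq i; rw [pow_succ']; exact (sub_eq_zero.mp h).symm
  have hP : ∀ n, poch (q ^ 2) (q ^ 2) n ≠ 0 := fun n => poch_ne_zero (fun i h => hQ i (by rw [h]; ring)) n
  have hp : ∀ n, poch q q n ≠ 0 := fun n => poch_ne_zero (fun i h => hq' i (by rw [h]; ring)) n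
  have main : ∀ N, (∑ ij ∈ antidiagonal N, q ^ ij.1 / (poch (q ^ 2) (q ^ 2) ij.1 * poch (q ^ 2) (q ^ 2) ij.2) =
      1 / poch q q N) ∧ (∑ ij ∈ antidiagonal N, (q ^ 2) ^ ij.2 * (q ^ ij.1 / (poch (q ^ 2) (q ^ 2) ij.1 * poch (q ^ 2) (q ^ 2) ij.2)) =
      q ^ N / poch q q N) := by
    intro N
    induction N with
    | zero => simp [poch_zero]
    | succ N ih =>
      obtain ⟨iA, iB⟩ := ih
      have k1 : ∑ ij ∈ antidiagonal (N+1), (1 - (q ^ 2) ^ ij.2) * (q ^ ij.1 / (poch (q ^ 2) (q ^ 2) ij.1 * poch (q ^ 2) (q ^ 2) ij.2)) = 1 / poch q q N := by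
        rw [← iA, Nat.sum_antidiagonal_succ']
        simp only [pow_zero, sub_self, zero_mul, zero_add]
        apply sum_congr rfl
        rintro ⟨i, j⟩ _
        simp only
        rw [poch_succ _ _ j]
        have := hQ j; have := hP i; have := hP j
        field_simp
        ring
      have k2 : ∑ ij ∈ antidiagonal (N+1), ((q ^ 2) ^ ij.2 * (1 - (q ^ 2) ^ ij.1)) * (q ^ ij.1 / (poch (q ^ 2) (q ^ 2) ij.1 * poch (q ^ 2) (q ^ 2) ij.2)) = q * (q ^ N / poch q q N) := by
        rw [← iB, Nat.sum_antidiagonal_succ, mul_sum]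
        simp only [pow_zero, sub_self, mul_zero, zero_mul, zero_add]
        apply sum_congr rfl
        rintro ⟨i, j⟩ _
        simp only
        rw [poch_succ _ _ i]
        have := hQ i; have := hP i; have := hP j
        field_simp
        ring
      have key : (1 - q ^ 2 * (q ^ 2) ^ N) * ∑ ij ∈ antidiagonal (N+1), q ^ ij.1 / (poch (q ^ 2) (q ^ 2) ij.1 * poch (q ^ 2) (q ^ 2) ij.2) = 1 / poch q q N + q * (q ^ N / poch q q N) := by
        rw [← k1, ← k2, mul_sum, ← sum_add_distrib]
        apply sum_congr rfl
        rintro ⟨i, j⟩ hij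
        rw [HasAntidiagonal.mem_antidiagonal] at hij
        simp only at hij ⊢
        have : q ^ 2 * (q ^ 2) ^ N = (q ^ 2) ^ i * (q ^ 2) ^ j := by rw [← pow_add, hij]; ring
        rw [this]; ring
      have hA : ∑ ij ∈ antidiagonal (N+1), q ^ ij.1 / (poch (q ^ 2) (q ^ 2) ij.1 * poch (q ^ 2) (q ^ 2) ij.2) = 1 / poch q q (N+1) := by
        apply mul_left_cancel₀ (hQ N)
        rw [key, poch_succ]
        have := hp N; have := hq' N
        field_simp
        ring
      refine ⟨hA, ?_⟩
      have : ∑ ij ∈ antidiagonal (N+1), (q ^ 2) ^ ij.2 * (q ^ ij.1 / (poch (q ^ 2) (q ^ 2) ij.1 * poch (q ^ 2) (q ^ 2) ij.2)) = 1 / poch q q (N+1) - 1 / poch q q N := by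
        rw [← hA, ← k1, ← sum_sub_distrib]
        apply sum_congr rfl
        intros; ring
      rw [this, poch_succ]
      have := hp N; have := hq' N
      field_simp
      ring
  exact (main N).1


/-- The partial theta-type sequence. -/
def sig (q : K) : ℕ → K
  | 0 => 1
  | r + 1 => q ^ (4 * r + 4) * sig q r + q ^ (3 * r + 3) + q ^ (r + 1)

/-- Differences of `sig`. -/
def del (q : K) : ℕ → K
  | 0 => 1
  | r + 1 => sig q (r + 1) - sig q r

/-- `F n r = 1/((Q)_{n-r}(Q)_{n+r})` with `Q = q^2`. -/
def FF (q : K) (n r : ℕ) : K := 1 / (poch (q ^ 2) (q ^ 2) (n - r) * poch (q ^ 2) (q ^ 2) (n + r))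

lemma abel (q : K) (n R : ℕ) :
    ∑ r ∈ range (R + 1), del q r * FF q n r =
    ∑ r ∈ range R, sig q r * (FF q n r - FF q n (r + 1)) + sig q R * FF q n R := by
  induction R with
  | zero => simp [del, sig]
  | succ R ih =>
    rw [sum_range_succ, ih, sum_range_succ]
    simp only [del]; ring

lemma poch_double (q : K) (n : ℕ) : poch q q (2 * n) = poch (q ^ 2) q n * poch (q ^ 2) (q ^ 2) n := by
  induction n with
  | zero => simp [poch_zero]
  | succ n ih =>
    rw [show 2 * (n + 1) = 2 * n + 1 + 1 by ring, poch_succ, poch_succ, ih, poch_succ, poch_succ]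
    ring

section


lemma nzQ (q : K) (hq : ∀ i, q ^ (i + 1) ≠ 1) (i : ℕ) : (1 : K) - q ^ 2 * (q ^ 2) ^ i ≠ 0 := fun h => by
    apply hq (2 * i + 1); rw [show q ^ (2 * i + 1 + 1) = q ^ 2 * (q ^ 2) ^ i by ring]
    exact (sub_eq_zero.mp h).symm

lemma nzP (q : K) (hq : ∀ i, q ^ (i + 1) ≠ 1) (n : ℕ) : poch (q ^ 2) (q ^ 2) n ≠ 0 :=
  poch_ne_zero (fun i h => nzQ q hq i (by rw [h]; ring)) n

lemma nzO (q : K) (hq : ∀ i, q ^ (i + 1) ≠ 1) (n : ℕ) : poch (q ^ 2) q n ≠ 0 :=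
  poch_ne_zero (fun i h => hq (2 * i) (by rw [← h]; ring)) n

lemma claimB_aux (q : K) (hq : ∀ i, q ^ (i + 1) ≠ 1) (n : ℕ) : ∀ R d : ℕ, n = R + d →
    ∑ r ∈ range R, sig q r * (FF q n r - FF q n (r + 1)) + sig q R * q ^ (2 * d) * FF q n R =
    q ^ n * ∑ i ∈ range (2 * R + 1), q ^ (d + i) /
      (poch (q ^ 2) (q ^ 2) (d + i) * poch (q ^ 2) (q ^ 2) (2 * n - (d + i))) := by
  intro R
  induction R with
  | zero =>
    intro d h
    simp only [zero_add] at h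
    subst h
    simp [sig, FF, two_mul]
    ring
  | succ R ih =>
    intro d h
    have h1 := ih (d + 1) (by omega)
    rw [sum_range_succ, show 2 * (R + 1) + 1 = (2 * R + 1) + 1 + 1 by ring, sum_range_succ,
      sum_range_succ']
    have e : ∑ i ∈ range (2 * R + 1), q ^ (d + (i + 1)) /
      (poch (q ^ 2) (q ^ 2) (d + (i + 1)) * poch (q ^ 2) (q ^ 2) (2 * n - (d + (i + 1))))
      = ∑ i ∈ range (2 * R + 1), q ^ (d + 1 + i) /
      (poch (q ^ 2) (q ^ 2) (d + 1 + i) * poch (q ^ 2) (q ^ 2) (2 * n - (d + 1 + i))) := by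
      apply sum_congr rfl; intro i _; rw [show d + (i + 1) = d + 1 + i by ring]
    rw [e, mul_add, mul_add, ← h1]
    subst h
    simp only [FF, sig]
    rw [show R + 1 + d - R = d + 1 by omega, show R + 1 + d - (R + 1) = d by omega,
      show R + 1 + d + (R + 1) = (R + 1 + d + R) + 1 by omega,
      show 2 * (R + 1 + d) - (d + 0) = (R + 1 + d + R) + 1 by omega,
      show d + (2 * R + 1 + 1) = (R + 1 + d + R) + 1 by omega,
      show 2 * (R + 1 + d) - (R + 1 + d + R + 1) = d by omega,
      poch_succ _ _ d, poch_succ _ _ (R + 1 + d + R)]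
    have := nzP q hq d; have := nzP q hq (R + 1 + d + R)
    have := nzQ q hq d; have := nzQ q hq (R + 1 + d + R)
    simp only [add_zero]
    generalize poch (q ^ 2) (q ^ 2) d = A at *
    generalize poch (q ^ 2) (q ^ 2) (R + 1 + d + R) = B at *
    have h3 : (1 : K) - q ^ (2 * d + 2) ≠ 0 := by
      rwa [show q ^ (2 * d + 2) = q ^ 2 * (q ^ 2) ^ d by ring]
    have h4 : (1 : K) - q ^ (2 * (R + 1 + d + R) + 2) ≠ 0 := by
      rwa [show q ^ (2 * (R + 1 + d + R) + 2) = q ^ 2 * (q ^ 2) ^ (R + 1 + d + R) by ring]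
    rw [show q ^ 2 * (q ^ 2) ^ d = q ^ (2 * d + 2) by ring,
      show q ^ 2 * (q ^ 2) ^ (R + 1 + d + R) = q ^ (2 * (R + 1 + d + R) + 2) by ring]
    field_simp
    ring

lemma claimB (q : K) (hq : ∀ i, q ^ (i + 1) ≠ 1) (n : ℕ) : ∑ r ∈ range (n + 1), del q r * FF q n r = q ^ n / poch q q (2 * n) := by
  rw [abel q]
  have h := claimB_aux q hq n n 0 (by ring)
  simp only [mul_zero, pow_zero, mul_one, zero_add] at h
  rw [h, div_eq_mul_one_div, ← rogers q hq (2 * n),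
    Nat.sum_antidiagonal_eq_sum_range_succ_mk]

lemma claimC (q : K) (hq : ∀ i, q ^ (i + 1) ≠ 1) (n r : ℕ) (hr : r ≤ n) :
    ∑ k ∈ Ico r (n + 1), poch (q ^ 2) q k * (-1) ^ k * q ^ (k ^ 2) / poch (q ^ 2) (q ^ 2) (n - k) * FF q k r
     = (-1) ^ r * q ^ (r ^ 2) * poch (q ^ 2) q n * FF q n r := by
  obtain ⟨m, rfl⟩ := Nat.exists_eq_add_of_le hr
  have hb : ∀ i, q ^ (2 * r + 1) * q ^ (2 * r + 1) * (q ^ 2) ^ i ≠ 1 := by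
    intro i h; apply hq (4 * r + 1 + 2 * i); rw [← h]; ring
  have h := chu (q ^ 2) (fun i h => nzQ q hq i (by rw [h]; ring)) (q ^ (2 * r + 1)) m (q ^ (2 * r + 1)) hb
  rw [Nat.sum_antidiagonal_eq_sum_range_succ_mk] at h
  rw [sum_Ico_eq_sum_range, show r + m + 1 - r = m + 1 by omega]
  have e1 : ∀ i, poch (q ^ 2) q (r + i) = poch (q ^ 2) q r * poch (q ^ 2) (q ^ (2 * r + 1)) i := by
    intro i; rw [poch_add]; congr 2; ring
  have e2 : ∀ i, poch (q ^ 2) (q ^ 2) (2 * r + i) = poch (q ^ 2) (q ^ 2) (2 * r) *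
      poch (q ^ 2) (q ^ (2 * r + 1) * q ^ (2 * r + 1)) i := by
    intro i; rw [poch_add]; congr 2; ring
  have hm : (-1) ^ r * q ^ (r ^ 2) * poch (q ^ 2) q (r + m) * FF q (r + m) r =
      (-1) ^ r * q ^ (r ^ 2) * poch (q ^ 2) q r / poch (q ^ 2) (q ^ 2) (2 * r) *
      (poch (q ^ 2) (q ^ (2 * r + 1)) m /
        (poch (q ^ 2) (q ^ 2) m * poch (q ^ 2) (q ^ (2 * r + 1) * q ^ (2 * r + 1)) m)) := by
    simp only [FF]
    rw [e1, show r + m - r = m by omega, show r + m + r = 2 * r + m by ring, e2]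
    have := nzP q hq m; have := nzP q hq (2 * r); have := poch_ne_zero hb m
    field_simp
  rw [hm, ← h, mul_sum]
  apply sum_congr rfl
  intro i hi
  have hi' : i ≤ m := by simp at hi; omega
  simp only [FF]
  rw [e1, show r + i - r = i by omega, show r + i + r = 2 * r + i by ring, e2,
    show r + m - (r + i) = m - i by omega]
  have hc : q ^ ((r + i) ^ 2) = q ^ (r ^ 2) * (q ^ (2 * r + 1)) ^ i * (q ^ 2) ^ (i.choose 2) := by
    rw [← pow_mul, ← pow_mul, ← pow_add, ← pow_add]
    congr 1
    have : i * (i - 1) = 2 * i.choose 2 := by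
      rw [Nat.choose_two_right, Nat.mul_div_cancel' (Nat.even_mul_pred_self i).two_dvd]
    rw [← this]
    rcases i with _ | i
    · simp
    · simp only [Nat.add_sub_cancel]; ring
  rw [hc, pow_add (-1 : K), neg_pow (q ^ (2 * r + 1)) i]
  have := nzP q hq i; have := nzP q hq (2 * r); have := poch_ne_zero hb i; have := nzP q hq (m - i)
  field_simp

lemma claimA (q : K) (hq : ∀ i, q ^ (i + 1) ≠ 1) (n : ℕ) : ∑ r ∈ range (n + 1), (-1) ^ r * q ^ (r ^ 2) * del q r * FF q n r =
    1 / poch (q ^ 2) q n := by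
  have hO := nzO q hq
  have h1 : ∀ r ∈ range (n + 1), (-1) ^ r * q ^ (r ^ 2) * del q r * FF q n r =
      ∑ k ∈ Ico r (n + 1), 1 / poch (q ^ 2) q n * del q r * (poch (q ^ 2) q k * (-1) ^ k * q ^ (k ^ 2) / poch (q ^ 2) (q ^ 2) (n - k) * FF q k r) := by
    intro r hr
    rw [← mul_sum, claimC q hq n r (by simp at hr; omega)]
    have := hO n
    field_simp
  rw [sum_congr rfl h1, range_eq_Ico, sum_Ico_Ico_comm]
  have h2 : ∀ k ∈ Ico 0 (n + 1), ∑ r ∈ Ico 0 (k + 1), 1 / poch (q ^ 2) q n * del q r * (poch (q ^ 2) q k * (-1) ^ k * q ^ (k ^ 2) / poch (q ^ 2) (q ^ 2) (n - k) * FF q k r)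
     = 1 / poch (q ^ 2) q n * (poch (q ^ 2) 0 k * (-q ^ 2) ^ k * (q ^ 2) ^ (k.choose 2) /
      (poch (q ^ 2) (q ^ 2) k * poch (q ^ 2) (q ^ 2) (n - k) * poch (q ^ 2) (0 * q ^ 2) k)) := by
    intro k hk
    have : ∀ r ∈ Ico 0 (k + 1), 1 / poch (q ^ 2) q n * del q r * (poch (q ^ 2) q k * (-1) ^ k * q ^ (k ^ 2) / poch (q ^ 2) (q ^ 2) (n - k) * FF q k r) = (1 / poch (q ^ 2) q n * (poch (q ^ 2) q k * (-1) ^ k * q ^ (k ^ 2) / poch (q ^ 2) (q ^ 2) (n - k))) * (del q r * FF q k r) := by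
      intros; ring
    rw [sum_congr rfl this, ← mul_sum, ← range_eq_Ico, claimB q hq k, poch_double q]
    have hz : poch (q ^ 2) (0 : K) k = 1 := by simp [poch]
    rw [zero_mul, hz, neg_pow (q ^ 2)]
    have hc : q ^ (k ^ 2) * q ^ k = (q ^ 2) ^ k * (q ^ 2) ^ (k.choose 2) := by
      rw [← pow_mul, ← pow_mul, ← pow_add, ← pow_add]
      congr 1
      have : k * (k - 1) = 2 * k.choose 2 := by
        rw [Nat.choose_two_right, Nat.mul_div_cancel' (Nat.even_mul_pred_self k).two_dvd]
      rw [← this]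
      rcases k with _ | i
      · simp
      · simp only [Nat.add_sub_cancel]; ring
    have a1 := hO n; have a2 := hO k; have a3 := nzP q hq k; have a4 := nzP q hq (n - k)
    rw [show (1 : K) * ((-1) ^ k * (q ^ 2) ^ k) * (q ^ 2) ^ k.choose 2 =
      (-1) ^ k * ((q ^ 2) ^ k * (q ^ 2) ^ k.choose 2) by ring, ← hc]
    field_simp
  rw [sum_congr rfl h2, ← mul_sum, ← range_eq_Ico]
  have h := chu (q ^ 2) (fun i h => nzQ q hq i (by rw [h]; ring)) (q ^ 2) n 0 (by simp)
  rw [Nat.sum_antidiagonal_eq_sum_range_succ_mk] at h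
  simp only at h
  rw [h]
  have := nzP q hq n
  have hz : poch (q ^ 2) (0 * q ^ 2) n = 1 := by simp [poch]
  rw [hz, mul_one, div_self this, mul_one]

lemma claimV (q : K) (hq : ∀ i, q ^ (i + 1) ≠ 1) (r M : ℕ) : ∑ m ∈ range (M + 1), poch (q ^ 2) (q ^ 2) (r + m) ^ 2 * q ^ (2 * (r + 1 + m)) * FF q (r + 1 + m) (r + 1)
    = q ^ (2 * (r + 1)) / (1 - q ^ (2 * (r + 1))) ^ 2 * (poch (q ^ 2) (q ^ 2) (r + 1 + M) ^ 2 * FF q (r + 1 + M) (r + 1)) := by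
  have hr : (1 : K) - q ^ (2 * (r + 1)) ≠ 0 := fun h => hq (2 * r + 1) (sub_eq_zero.mp h).symm
  induction M with
  | zero =>
    simp only [zero_add, sum_range_one, add_zero]
    rw [show poch (q ^ 2) (q ^ 2) (r + 1) = _ from poch_succ _ _ r,
      show q ^ 2 * (q ^ 2) ^ r = q ^ (2 * (r + 1)) by ring]
    field_simp
  | succ M ih =>
    rw [sum_range_succ, ih]
    simp only [FF]
    rw [show r + (M + 1) = r + 1 + M by ring, show r + 1 + (M + 1) - (r + 1) = M + 1 by omega,
      show r + 1 + (M + 1) + (r + 1) = (r + 1 + M + (r + 1)) + 1 by ring,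
      show r + 1 + (M + 1) = (r + 1 + M) + 1 by ring, show r + 1 + M - (r + 1) = M by omega,
      poch_succ _ _ M, poch_succ _ _ (r + 1 + M), poch_succ _ _ (r + 1 + M + (r + 1))]
    have := nzP q hq M; have := nzP q hq (r + 1 + M + (r + 1))
    have a1 := nzQ q hq M; have a2 := nzQ q hq (r + 1 + M + (r + 1))
    rw [show q ^ 2 * (q ^ 2) ^ M = q ^ (2 * M + 2) by ring] at *
    rw [show q ^ 2 * (q ^ 2) ^ (r + 1 + M + (r + 1)) = q ^ (2 * (r + 1 + M + (r + 1)) + 2) by ring] at *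
    generalize poch (q ^ 2) (q ^ 2) M = A at *
    generalize poch (q ^ 2) (q ^ 2) (r + 1 + M + (r + 1)) = B at *
    field_simp
    ring

lemma finite_id (q : K) (hq : ∀ i, q ^ (i + 1) ≠ 1) (N : ℕ) :
    ∑ n ∈ range N, poch (q ^ 2) (q ^ 2) n ^ 2 * q ^ (2 * (n + 1)) / poch (q ^ 2) q (n + 1) =
    ∑ n ∈ range N, q ^ (2 * (n + 1)) / (1 - q ^ (2 * (n + 1))) ^ 2 +
    ∑ r ∈ range N, (-1) ^ (r + 1) * q ^ ((r + 1) ^ 2) * del q (r + 1) *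
      (q ^ (2 * (r + 1)) / (1 - q ^ (2 * (r + 1))) ^ 2) *
        (poch (q ^ 2) (q ^ 2) N ^ 2 * FF q N (r + 1)) := by
  have h1 : ∀ n ∈ range N, poch (q ^ 2) (q ^ 2) n ^ 2 * q ^ (2 * (n + 1)) / poch (q ^ 2) q (n + 1)
      = q ^ (2 * (n + 1)) / (1 - q ^ (2 * (n + 1))) ^ 2 + ∑ r ∈ Ico 0 (n + 1),
        poch (q ^ 2) (q ^ 2) n ^ 2 * q ^ (2 * (n + 1)) *
        ((-1) ^ (r + 1) * q ^ ((r + 1) ^ 2) * del q (r + 1) * FF q (n + 1) (r + 1)) := by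
    intro n _
    rw [div_eq_mul_one_div, ← claimA q hq (n + 1), sum_range_succ', mul_add, ← mul_sum,
      ← range_eq_Ico, add_comm]
    congr 1
    simp only [FF, del, Nat.sub_zero, add_zero]
    rw [poch_succ]
    have a1 := nzP q hq n; have a2 := nzQ q hq n
    rw [show q ^ 2 * (q ^ 2) ^ n = q ^ (2 * (n + 1)) by ring] at *
    simp only [pow_zero, ne_eq, OfNat.ofNat_ne_zero, not_false_eq_true, zero_pow, mul_one, one_mul]
    field_simp
  rw [sum_congr rfl h1, sum_add_distrib]
  congr 1
  rw [range_eq_Ico, ← sum_Ico_Ico_comm]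
  apply sum_congr rfl
  intro r hr
  have hr' : r < N := by simpa using hr
  obtain ⟨M, rfl⟩ : ∃ M, N = r + 1 + M := Nat.exists_eq_add_of_le hr'
  rw [sum_Ico_eq_sum_range, show r + 1 + M - r = M + 1 by omega, mul_assoc _ (_ / _), ← claimV q hq r M, mul_sum]
  apply sum_congr rfl
  intro m _
  rw [show r + m + 1 = r + 1 + m by ring]
  ring

end
end QS

namespace QS
open Finset PowerSeries

/-- `1/(1-X^k)` as a power series. -/
noncomputable def G (R : Type*) [CommRing R] (k : ℕ) : PowerSeries R :=
  PowerSeries.mk fun i => if k ∣ i then 1 else 0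

lemma G_mul (R : Type*) [CommRing R] (k : ℕ) (hk : 0 < k) : (1 - (X : PowerSeries R) ^ k) * G R k = 1 := by
  ext i
  rw [sub_mul, one_mul, map_sub, coeff_X_pow_mul', G, coeff_mk, coeff_one]
  by_cases h : k ≤ i
  · rw [if_pos h, coeff_mk, if_neg (by omega : i ≠ 0)]
    have : k ∣ i - k ↔ k ∣ i := by
      constructor
      · intro h1; have := dvd_add h1 (dvd_refl k); rwa [Nat.sub_add_cancel h] at this
      · intro h1; exact Nat.dvd_sub h1 (dvd_refl k)
    simp [this]
  · rw [if_neg h]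
    rcases Nat.eq_zero_or_pos i with rfl | hi
    · simp
    · rw [if_neg (fun hd => h (Nat.le_of_dvd hi hd)), if_neg (by omega)]; simp

lemma coeff_X_pow_mul_G (R : Type*) [CommRing R] (a k M : ℕ) :
    coeff M ((X : PowerSeries R) ^ a * G R k) = if a ≤ M ∧ k ∣ M - a then 1 else 0 := by
  rw [coeff_X_pow_mul', G]
  by_cases h : a ≤ M
  · simp [h]
  · simp [h]

abbrev F2 := PowerSeries (ZMod 2)

noncomputable def PP (n : ℕ) : F2 := ∏ i ∈ range n, (1 - X ^ (2 * (i + 1)))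
noncomputable def PG (n : ℕ) : F2 := ∏ i ∈ range n, G (ZMod 2) (2 * (i + 1))
noncomputable def OG (n : ℕ) : F2 := ∏ i ∈ range n, G (ZMod 2) (2 * i + 1)
noncomputable def sg : ℕ → F2
  | 0 => 1
  | r + 1 => X ^ (4 * r + 4) * sg r + X ^ (3 * r + 3) + X ^ (r + 1)
noncomputable def WW (N r : ℕ) : F2 := PP N ^ 2 * (PG (N - r) * PG (N + r))

lemma PP_PG (n : ℕ) : PP n * PG n = 1 := by
  rw [PP, PG, ← prod_mul_distrib]
  exact prod_eq_one fun i _ => G_mul _ _ (by omega)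

lemma two_zero : (2 : F2) = 0 := by
  have : (2 : ZMod 2) = 0 := by decide
  have h : (C (2 : ZMod 2) : F2) = 0 := by rw [this, map_zero]
  rwa [map_ofNat] at h

lemma term_aux {K : Type*} [Field K] (q s : K) (r : ℕ) (n1 : 1 - q ^ (2 * (r + 1)) ≠ 0) :
    q ^ ((r + 1) ^ 2) * ((1 - q ^ (2 * (r + 1))) ^ 2 * s + q ^ (r + 1) * (1 - q ^ (2 * (r + 1)))) *
      (q ^ (2 * (r + 1)) / (1 - q ^ (2 * (r + 1))) ^ 2) =
    q ^ ((r + 1) ^ 2 + 2 * (r + 1)) * s + q ^ ((r + 1) ^ 2 + 3 * (r + 1)) * (1 - q ^ (2 * (r + 1)))⁻¹ := by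
  have h1 : q ^ ((r + 1) ^ 2 + 2 * (r + 1)) = q ^ ((r + 1) ^ 2) * q ^ (2 * (r + 1)) := by ring
  have h2 : q ^ ((r + 1) ^ 2 + 3 * (r + 1)) = q ^ ((r + 1) ^ 2) * q ^ (2 * (r + 1)) * q ^ (r + 1) := by ring
  rw [h1, h2]
  generalize 1 - q ^ (2 * (r + 1)) = v at *
  field_simp

lemma identity_F2 (N : ℕ) :
    ∑ n ∈ range N, PP n ^ 2 * X ^ (2 * (n + 1)) * OG (n + 1) =
    ∑ n ∈ range N, X ^ (2 * (n + 1)) * G (ZMod 2) (4 * (n + 1)) +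
    ∑ r ∈ range N, (X ^ ((r + 1) ^ 2 + 2 * (r + 1)) * sg r +
      X ^ ((r + 1) ^ 2 + 3 * (r + 1)) * G (ZMod 2) (2 * (r + 1))) * WW N (r + 1) := by
  let K := FractionRing F2
  let ι : F2 →+* K := algebraMap F2 K
  have hinj : Function.Injective ι := IsFractionRing.injective F2 K
  have hXk : ∀ k, 0 < k → ∀ x : F2, x = X ^ k → x ≠ 1 := by
    rintro k hk x rfl h
    have := congrArg (coeff 0) h
    rw [coeff_X_pow, if_neg (by omega)] at this
    simp at this
  have hq : ∀ i, (ι X) ^ (i + 1) ≠ 1 := by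
    intro i h
    rw [← map_pow, ← map_one ι] at h
    exact hXk (i + 1) (by omega) _ rfl (hinj h)
  have hG : ∀ k, 0 < k → ι (G (ZMod 2) k) = (1 - (ι X) ^ k)⁻¹ := by
    intro k hk
    apply eq_inv_of_mul_eq_one_right
    rw [← map_pow, ← map_one ι, ← map_sub, ← map_mul, G_mul _ _ hk]
  have hPP : ∀ n, ι (PP n) = poch ((ι X) ^ 2) ((ι X) ^ 2) n := by
    intro n
    simp only [PP, poch, map_prod, map_sub, map_one, map_pow]
    apply prod_congr rfl; intro i _; ring
  have hPG : ∀ n, ι (PG n) = (poch ((ι X) ^ 2) ((ι X) ^ 2) n)⁻¹ := by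
    intro n
    apply eq_inv_of_mul_eq_one_right
    rw [← hPP, ← map_mul, PP_PG, map_one]
  have hOG : ∀ n, ι (OG n) = (poch ((ι X) ^ 2) (ι X) n)⁻¹ := by
    intro n
    simp only [OG, poch, map_prod]
    rw [← prod_inv_distrib]
    apply prod_congr rfl; intro i _
    rw [hG _ (by omega)]; congr 2; ring
  have hsg : ∀ n, ι (sg n) = sig (ι X) n := by
    intro n
    induction n with
    | zero => simp [sg, sig]
    | succ n ih => simp only [sg, sig, map_add, map_mul, map_pow, ih]
  have hWW : ∀ N r, ι (WW N r) = poch ((ι X) ^ 2) ((ι X) ^ 2) N ^ 2 * FF (ι X) N r := by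
    intro N r
    simp only [WW, FF, map_mul, map_pow, hPP, hPG, one_div, mul_inv]
  have h2 : (2 : K) = 0 := by
    have := congrArg ι two_zero
    rwa [map_ofNat, map_zero] at this
  have hneg : (-1 : K) = 1 := by linear_combination -h2
  apply hinj
  have h := finite_id (ι X) hq N
  simp only [map_sum, map_add, map_mul, map_pow, hWW, hPP, hOG, hsg]
  simp only [div_eq_mul_inv _ (poch _ _ _)] at h
  rw [h]
  have nz : ∀ k, 0 < k → (1 : K) - (ι X) ^ k ≠ 0 := by
    intro k hk h
    obtain ⟨j, rfl⟩ : ∃ j, k = j + 1 := ⟨k - 1, by omega⟩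
    exact hq j (sub_eq_zero.mp h).symm
  have sq : ∀ k, (1 - (ι X) ^ k) ^ 2 = 1 - (ι X) ^ (2 * k) := by
    intro k
    linear_combination ((ι X) ^ (2 * k) - (ι X) ^ k) * h2
  congr 1
  · apply sum_congr rfl
    intro n _
    rw [hG _ (by omega), sq, div_eq_mul_inv]
    congr 3; ring_nf
  · apply sum_congr rfl
    intro r _
    congr 1
    rw [hG _ (by omega), hneg, one_pow, one_mul]
    simp only [del, sig]
    have n1 := nz (2 * (r + 1)) (by omega)
    have key : 1 - (ι X) ^ (4 * r + 4) = (1 - ι X ^ (2 * (r + 1))) ^ 2 := by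
      rw [sq]; congr 2; ring
    have e1 : ι X ^ (4 * r + 4) * sig (ι X) r + ι X ^ (3 * r + 3) + ι X ^ (r + 1) - sig (ι X) r
      = (1 - ι X ^ (2 * (r + 1))) ^ 2 * sig (ι X) r + ι X ^ (r + 1) * (1 - ι X ^ (2 * (r + 1))) := by
      rw [← key]
      linear_combination (ι X ^ (4 * r + 4) * sig (ι X) r + ι X ^ (3 * r + 3) - sig (ι X) r) * h2
    rw [e1]
    exact term_aux (ι X) _ r n1

lemma WW_congr (N r : ℕ) (hr : r ≤ N) : ∃ c : F2, WW N r = 1 + X ^ (2 * (N - r) + 2) * c := by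
  -- products of high factors are 1 mod X^(2(N-r)+2)
  have aux : ∀ a m : ℕ, ∃ c : F2, PP (a + m) = PP a * (1 + X ^ (2 * a + 2) * c) := by
    intro a m
    induction m with
    | zero => exact ⟨0, by simp⟩
    | succ m ih =>
      obtain ⟨c, hc⟩ := ih
      refine ⟨c - X ^ (2 * m) * (1 + X ^ (2 * a + 2) * c), ?_⟩
      rw [← add_assoc, PP, prod_range_succ, ← PP, hc]
      ring
  obtain ⟨a, rfl⟩ := Nat.exists_eq_add_of_le' hr
  rw [WW, show a + r - r = a by omega]
  obtain ⟨c, hc⟩ := aux a r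
  obtain ⟨d, hd⟩ := aux (a + r) r
  have h1 := PP_PG a
  have h2 := PP_PG (a + r + r)
  -- W = PP(N)/PP(a) * PP(N)/PP(N+r)
  set u : F2 := 1 + X ^ (2 * (a + r) + 2) * d with hu
  have hX : (X : F2) ^ (2 * (a + r) + 2) = X ^ (2 * a + 2) * X ^ (2 * r) := by ring
  have e1 : PP (a + r) * PG a = 1 + X ^ (2 * a + 2) * c := by
    rw [hc]; linear_combination (1 + X ^ (2 * a + 2) * c) * h1
  have e2 : PP (a + r) * PG (a + r + r) * u = 1 := by
    rw [← h2, hd]; ring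
  have e3 : PP (a + r) * PG (a + r + r) *
      (1 + X ^ (2 * a + 2) * X ^ (2 * r) * d) = 1 := by
    have h5 := e2
    rw [hu, hX] at h5
    exact h5
  have e4 : PP (a + r) ^ 2 * (PG a * PG (a + r + r)) =
    (PP (a + r) * PG a) * (PP (a + r) * PG (a + r + r)) := by ring
  rw [e4, e1]
  clear e2 e4
  generalize PP (a + r) * PG (a + r + r) = v at *
  refine ⟨c - (1 + X ^ (2 * a + 2) * c) * (X ^ (2 * r) * d * v), ?_⟩
  linear_combination (1 + X ^ (2 * a + 2) * c) * e3

/-- The Hecke-type index set. -/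
def hecke (n : ℕ) : Finset (ℕ × ℕ) :=
  (range n ×ˢ range (2 * n + 2)).filter fun p => p.2 < 2 * (p.1 + 1) ∧
    n + p.2 * (p.2 + 1) / 2 = 3 * (p.1 + 1) ^ 2

lemma tri_le (r j : ℕ) (h : j ≤ 2 * r) : j * (j + 1) / 2 ≤ 2 * r ^ 2 + r := by
  have : j * (j + 1) ≤ 2 * r * (2 * r + 1) := by gcongr
  have e : 2 * r * (2 * r + 1) = 2 * (2 * r ^ 2 + r) := by ring
  omega

lemma sg_eq (r : ℕ) : sg r = ∑ j ∈ range (2 * r + 1), X ^ (2 * r ^ 2 + 2 * r - j * (j + 1) / 2) := by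
  induction r with
  | zero => simp [sg]
  | succ r ih =>
    rw [sg, ih, show 2 * (r + 1) + 1 = 2 * r + 1 + 1 + 1 by ring, mul_sum, sum_range_succ _ (2 * r + 1 + 1), sum_range_succ _ (2 * r + 1)]
    congr 2
    · apply sum_congr rfl
      intro j hj
      rw [← pow_add]
      congr 1
      have := tri_le r j (by simp at hj; omega)
      have e : 2 * (r + 1) ^ 2 = 2 * r ^ 2 + 4 * r + 2 := by ring
      omega
    · congr 1
      have e : (2 * r + 1) * (2 * r + 1 + 1) = 2 * (2 * r ^ 2 + 3 * r + 1) := by ring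
      have e' : 2 * (r + 1) ^ 2 = 2 * r ^ 2 + 4 * r + 2 := by ring
      omega
    · congr 1
      have e : (2 * r + 1 + 1) * (2 * r + 1 + 1 + 1) = 2 * (2 * r ^ 2 + 5 * r + 3) := by ring
      have e' : 2 * (r + 1) ^ 2 = 2 * r ^ 2 + 4 * r + 2 := by ring
      omega

lemma hecke_term (r : ℕ) : X ^ ((r + 1) ^ 2 + 2 * (r + 1)) * sg r + X ^ ((r + 1) ^ 2 + (r + 1)) =
    ∑ j ∈ range (2 * (r + 1)), (X : F2) ^ (3 * (r + 1) ^ 2 - j * (j + 1) / 2) := by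
  rw [sg_eq, mul_sum, show 2 * (r + 1) = 2 * r + 1 + 1 by ring, sum_range_succ _ (2 * r + 1)]
  congr 1
  · apply sum_congr rfl
    intro j hj
    rw [← pow_add]
    congr 1
    have := tri_le r j (by simp at hj; omega)
    have e : 3 * (r + 1) ^ 2 = 3 * r ^ 2 + 6 * r + 3 := by ring
    have e' : (r + 1) ^ 2 = r ^ 2 + 2 * r + 1 := by ring
    omega
  · congr 1
    have e : (2 * r + 1) * (2 * r + 1 + 1) = 2 * (2 * r ^ 2 + 3 * r + 1) := by ring
    have e' : (r + 1) ^ 2 = r ^ 2 + 2 * r + 1 := by ring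
    omega

lemma div_count (M : ℕ) :
    ((range M).filter fun k => (k + 1) ^ 2 + (k + 1) ≤ M ∧ 2 * (k + 1) ∣ M - ((k + 1) ^ 2 + (k + 1))).card =
    ((range M).filter fun k => 2 * (k + 1) ≤ M ∧ 4 * (k + 1) ∣ M - 2 * (k + 1)).card := by
  rcases Nat.eq_zero_or_pos M with rfl | hM
  · simp
  set D := (M.divisorsAntidiagonal).filter fun p => (p.1 + p.2) % 2 = 1 with hD
  have memD : ∀ a b, (a, b) ∈ D ↔ a * b = M ∧ (a + b) % 2 = 1 := by
    intro a b
    simp only [hD, mem_filter, Nat.mem_divisorsAntidiagonal]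
    constructor
    · rintro ⟨⟨h1, _⟩, h2⟩; exact ⟨h1, h2⟩
    · rintro ⟨h1, h2⟩; exact ⟨⟨h1, by omega⟩, h2⟩
  have s1 : (D.filter fun p => p.1 < p.2).card = (D.filter fun p => ¬ p.1 < p.2).card := by
    apply card_nbij' Prod.swap Prod.swap
    · rintro ⟨a, b⟩ h
      simp only [coe_filter, Set.mem_ofPred_eq, memD, Prod.swap_prod_mk] at h ⊢
      exact ⟨⟨by rw [mul_comm]; exact h.1.1, by omega⟩, by omega⟩
    · rintro ⟨a, b⟩ h
      simp only [coe_filter, Set.mem_ofPred_eq, memD, Prod.swap_prod_mk] at h ⊢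
      exact ⟨⟨by rw [mul_comm]; exact h.1.1, by omega⟩, by omega⟩
    · intro x _; simp
    · intro x _; simp
  have s2 : (D.filter fun p => p.1 % 2 = 0).card = (D.filter fun p => ¬ p.1 % 2 = 0).card := by
    apply card_nbij' Prod.swap Prod.swap
    · rintro ⟨a, b⟩ h
      simp only [coe_filter, Set.mem_ofPred_eq, memD, Prod.swap_prod_mk] at h ⊢
      exact ⟨⟨by rw [mul_comm]; exact h.1.1, by omega⟩, by omega⟩
    · rintro ⟨a, b⟩ h
      simp only [coe_filter, Set.mem_ofPred_eq, memD, Prod.swap_prod_mk] at h ⊢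
      exact ⟨⟨by rw [mul_comm]; exact h.1.1, by omega⟩, by omega⟩
    · intro x _; simp
    · intro x _; simp
  have t1 := card_filter_add_card_filter_not (s := D) (fun p => p.1 < p.2)
  have t2 := card_filter_add_card_filter_not (s := D) (fun p => p.1 % 2 = 0)
  have c1 : ((range M).filter fun k => (k + 1) ^ 2 + (k + 1) ≤ M ∧ 2 * (k + 1) ∣ M - ((k + 1) ^ 2 + (k + 1))).card = (D.filter fun p => p.1 < p.2).card := by
    apply card_nbij' (fun k => (k + 1, M / (k + 1))) (fun p => p.1 - 1)
    · intro k hk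
      simp only [coe_filter, Set.mem_ofPred_eq, memD] at hk ⊢
      obtain ⟨_, h1, c, hc⟩ := hk
      have e : M = (k + 1) * (k + 1 + 1 + 2 * c) := by
        have : M = ((k + 1) ^ 2 + (k + 1)) + 2 * (k + 1) * c := by omega
        rw [this]; ring
      have e2 : M / (k + 1) = k + 1 + 1 + 2 * c := by
        rw [e, Nat.mul_div_cancel_left _ (by omega)]
      rw [e2]
      exact ⟨⟨e.symm, by omega⟩, by omega⟩
    · rintro ⟨a, b⟩ h
      simp only [coe_filter, Set.mem_ofPred_eq, memD, mem_range] at h ⊢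
      obtain ⟨⟨h1, h2⟩, h3⟩ := h
      have ha : 0 < a := Nat.pos_of_ne_zero (by rintro rfl; omega)
      obtain ⟨k, rfl⟩ : ∃ k, a = k + 1 := ⟨a - 1, by omega⟩
      obtain ⟨c, rfl⟩ : ∃ c, b = k + 1 + 1 + 2 * c := ⟨(b - (k + 2)) / 2, by omega⟩
      have e : M = ((k + 1) ^ 2 + (k + 1)) + 2 * (k + 1) * c := by rw [← h1]; ring
      simp only [Nat.add_sub_cancel]
      refine ⟨by nlinarith, by omega, ?_⟩
      rw [e, Nat.add_sub_cancel_left]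
      exact dvd_mul_right _ _
    · intro k _; simp
    · rintro ⟨a, b⟩ h
      simp only [coe_filter, Set.mem_ofPred_eq, memD] at h
      obtain ⟨⟨h1, h2⟩, h3⟩ := h
      have ha : 0 < a := Nat.pos_of_ne_zero (by rintro rfl; omega)
      simp only
      rw [Nat.sub_add_cancel ha, ← h1, Nat.mul_div_cancel_left _ ha]
  have c2 : ((range M).filter fun k => 2 * (k + 1) ≤ M ∧ 4 * (k + 1) ∣ M - 2 * (k + 1)).card = (D.filter fun p => p.1 % 2 = 0).card := by
    apply card_nbij' (fun k => (2 * (k + 1), M / (2 * (k + 1)))) (fun p => p.1 / 2 - 1)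
    · intro k hk
      simp only [coe_filter, Set.mem_ofPred_eq, memD] at hk ⊢
      obtain ⟨_, h1, c, hc⟩ := hk
      have e : M = (2 * (k + 1)) * (1 + 2 * c) := by
        have : M = 2 * (k + 1) + 4 * (k + 1) * c := by omega
        rw [this]; ring
      have e2 : M / (2 * (k + 1)) = 1 + 2 * c := by
        rw [e, Nat.mul_div_cancel_left _ (by omega)]
      rw [e2]
      exact ⟨⟨e.symm, by omega⟩, by omega⟩
    · rintro ⟨a, b⟩ h
      simp only [coe_filter, Set.mem_ofPred_eq, memD, mem_range] at h ⊢
      obtain ⟨⟨h1, h2⟩, h3⟩ := h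
      have ha : 0 < a := Nat.pos_of_ne_zero (by rintro rfl; omega)
      obtain ⟨k, rfl⟩ : ∃ k, a = 2 * (k + 1) := ⟨a / 2 - 1, by omega⟩
      obtain ⟨c, rfl⟩ : ∃ c, b = 1 + 2 * c := ⟨b / 2, by omega⟩
      have e : M = 2 * (k + 1) + 4 * (k + 1) * c := by rw [← h1]; ring
      rw [show 2 * (k + 1) / 2 - 1 = k by omega]
      refine ⟨by nlinarith, by omega, ?_⟩
      rw [e, Nat.add_sub_cancel_left]
      exact dvd_mul_right _ _
    · intro k _; simp
    · rintro ⟨a, b⟩ h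
      simp only [coe_filter, Set.mem_ofPred_eq, memD] at h
      obtain ⟨⟨h1, h2⟩, h3⟩ := h
      have ha : 0 < a := Nat.pos_of_ne_zero (by rintro rfl; omega)
      simp only
      rw [show 2 * (a / 2 - 1 + 1) = a by omega, ← h1, Nat.mul_div_cancel_left _ ha]
  rw [c1, c2]
  omega

lemma coeff_hecke (M : ℕ) :
    coeff M (∑ r ∈ range M, (X ^ ((r + 1) ^ 2 + 2 * (r + 1)) * sg r + X ^ ((r + 1) ^ 2 + (r + 1)))) =
    ((hecke M).card : ZMod 2) := by
  rw [hecke, card_filter, sum_product]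
  simp only [hecke_term, map_sum, coeff_X_pow]
  push_cast
  apply sum_congr rfl
  intro r hr
  have hr' : r < M := by simpa using hr
  rw [← sum_subset (s₁ := range (2 * (r + 1))) (s₂ := range (2 * M + 2))]
  · apply sum_congr rfl
    intro j hj
    have hj' : j < 2 * (r + 1) := by simpa using hj
    congr 1
    have h1 : j * (j + 1) / 2 ≤ 3 * (r + 1) ^ 2 := by
      have := tri_le (r + 1) j (by omega)
      nlinarith
    apply propext
    constructor
    · intro h; exact ⟨hj', by omega⟩
    · intro h; omega
  · intro j hj; simp at hj ⊢; omega
  · intro j _ hj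
    rw [if_neg]
    simp at hj; omega

theorem main_F2 (M : ℕ) :
    coeff M (∑ n ∈ range M, PP n ^ 2 * X ^ (2 * (n + 1)) * OG (n + 1)) = ((hecke M).card : ZMod 2) := by
  rw [identity_F2, ← coeff_hecke, map_add]
  have e1 : coeff M (∑ r ∈ range M, (X ^ ((r + 1) ^ 2 + 2 * (r + 1)) * sg r +
      X ^ ((r + 1) ^ 2 + 3 * (r + 1)) * G (ZMod 2) (2 * (r + 1))) * WW M (r + 1)) =
      coeff M (∑ r ∈ range M, (X ^ ((r + 1) ^ 2 + 2 * (r + 1)) * sg r +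
      X ^ ((r + 1) ^ 2 + 3 * (r + 1)) * G (ZMod 2) (2 * (r + 1)))) := by
    rw [map_sum, map_sum]
    apply sum_congr rfl
    intro r hr
    have hr' : r < M := by simpa using hr
    obtain ⟨c, hc⟩ := WW_congr M (r + 1) hr'
    rw [hc, mul_add, mul_one, map_add]
    have : (X ^ ((r + 1) ^ 2 + 2 * (r + 1)) * sg r +
      X ^ ((r + 1) ^ 2 + 3 * (r + 1)) * G (ZMod 2) (2 * (r + 1))) * (X ^ (2 * (M - (r + 1)) + 2) * c)
      = X ^ (((r + 1) ^ 2 + 2 * (r + 1)) + (2 * (M - (r + 1)) + 2)) * ((sg r + X ^ (r + 1) * G (ZMod 2) (2 * (r + 1))) * c) := by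
      ring
    rw [this, coeff_X_pow_mul', if_neg, add_zero]
    have := Nat.zero_le ((r + 1) ^ 2)
    omega
  have e2 : ∀ r, X ^ ((r + 1) ^ 2 + 2 * (r + 1)) * sg r +
      X ^ ((r + 1) ^ 2 + 3 * (r + 1)) * G (ZMod 2) (2 * (r + 1)) =
      (X ^ ((r + 1) ^ 2 + 2 * (r + 1)) * sg r + X ^ ((r + 1) ^ 2 + (r + 1))) +
      X ^ ((r + 1) ^ 2 + (r + 1)) * G (ZMod 2) (2 * (r + 1)) := by
    intro r
    have h := G_mul (ZMod 2) (2 * (r + 1)) (by omega)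
    linear_combination - (X ^ ((r + 1) ^ 2 + (r + 1))) * h - X ^ ((r + 1) ^ 2 + (r + 1)) * two_zero * 1 + 0 * h
  rw [e1, sum_congr rfl (fun r _ => e2 r), sum_add_distrib, map_add]
  have e3 : coeff M (∑ n ∈ range M, (X : F2) ^ (2 * (n + 1)) * G (ZMod 2) (4 * (n + 1))) =
    coeff M (∑ r ∈ range M, (X : F2) ^ ((r + 1) ^ 2 + (r + 1)) * G (ZMod 2) (2 * (r + 1))) := by
    have h := congrArg (Nat.cast (R := ZMod 2)) (div_count M)
    rw [card_filter, card_filter] at h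
    push_cast at h
    simp only [map_sum, coeff_X_pow_mul_G]
    exact h.symm
  rw [e3]
  have h2 : ∀ x : ZMod 2, x + x = 0 := by decide
  generalize coeff M (∑ r ∈ range M, (X : F2) ^ ((r + 1) ^ 2 + (r + 1)) * G (ZMod 2) (2 * (r + 1))) = x
  linear_combination h2 x

end QS

namespace QS
open Finset PowerSeries

/-- A power series with nonnegative integer coefficients represents the value `v` at `q`. -/
def Rep (q : ℝ) (f : PowerSeries ℤ) (v : ℝ) : Prop :=
  (∀ i, 0 ≤ coeff i f) ∧ HasSum (fun i => ((coeff i f : ℤ) : ℝ) * q ^ i) v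

lemma Rep_mul {q : ℝ} (hq : 0 < q) {f g : PowerSeries ℤ} {v w : ℝ} (hf : Rep q f v) (hg : Rep q g w) :
    Rep q (f * g) (v * w) := by
  constructor
  · intro i
    rw [coeff_mul]
    exact sum_nonneg fun p _ => mul_nonneg (hf.1 _) (hg.1 _)
  · have n1 : Summable fun i => ‖((coeff i f : ℤ) : ℝ) * q ^ i‖ := hf.2.summable.norm
    have n2 : Summable fun i => ‖((coeff i g : ℤ) : ℝ) * q ^ i‖ := hg.2.summable.norm
    have h1 := tsum_mul_tsum_eq_tsum_sum_antidiagonal_of_summable_norm n1 n2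
    have h2 := (summable_norm_sum_mul_antidiagonal_of_summable_norm n1 n2).of_norm
    rw [hf.2.tsum_eq, hg.2.tsum_eq] at h1
    rw [h1]
    have e : (fun i => ((coeff i (f * g) : ℤ) : ℝ) * q ^ i) = fun n => ∑ kl ∈ antidiagonal n,
        ((coeff kl.1 f : ℤ) : ℝ) * q ^ kl.1 * (((coeff kl.2 g : ℤ) : ℝ) * q ^ kl.2) := by
      funext n
      rw [coeff_mul]
      push_cast
      rw [sum_mul]
      apply sum_congr rfl
      intro p hp
      rw [HasAntidiagonal.mem_antidiagonal] at hp
      rw [← hp, pow_add]; ring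
    rw [e]
    exact h2.hasSum

lemma Rep_X_pow (q : ℝ) (k : ℕ) : Rep q (X ^ k) (q ^ k) := by
  constructor
  · intro i; rw [coeff_X_pow]; split_ifs <;> simp
  · have := hasSum_single (f := fun i => ((coeff i ((X : PowerSeries ℤ) ^ k) : ℤ) : ℝ) * q ^ i) k
      (by intro i hi; rw [coeff_X_pow, if_neg hi]; simp)
    simpa [coeff_X_pow] using this

lemma Rep_one (q : ℝ) : Rep q 1 1 := by simpa using Rep_X_pow q 0

lemma Rep_add {q : ℝ} {f g : PowerSeries ℤ} {v w : ℝ} (hf : Rep q f v) (hg : Rep q g w) :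
    Rep q (f + g) (v + w) := by
  constructor
  · intro i; rw [map_add]; exact add_nonneg (hf.1 i) (hg.1 i)
  · have := hf.2.add hg.2
    simpa [add_mul] using this

lemma Rep_G {q : ℝ} (hq : 0 < q) (hq1 : q < 1) (k : ℕ) (hk : 0 < k) :
    Rep q (G ℤ k) (1 - q ^ k)⁻¹ := by
  constructor
  · intro i; rw [G, coeff_mk]; split_ifs <;> simp
  · have h := hasSum_geometric_of_lt_one (r := q ^ k) (by positivity) (pow_lt_one₀ hq.le hq1 hk.ne')
    have hinj : Function.Injective fun j : ℕ => k * j := fun a b h => Nat.eq_of_mul_eq_mul_left hk h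
    rw [← hinj.hasSum_iff]
    · convert h using 1
      funext j
      simp [G, pow_mul]
    · intro x hx
      rw [G, coeff_mk, if_neg]
      · simp
      · rintro ⟨c, rfl⟩; exact hx ⟨c, rfl⟩

lemma Rep_prod {q : ℝ} (hq : 0 < q) (f : ℕ → PowerSeries ℤ) (v : ℕ → ℝ) (h : ∀ i, Rep q (f i) (v i)) (n : ℕ) :
    Rep q (∏ i ∈ range n, f i) (∏ i ∈ range n, v i) := by
  induction n with
  | zero => simpa using Rep_one q
  | succ n ih => rw [prod_range_succ, prod_range_succ]; exact Rep_mul hq ih (h n)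

noncomputable def gg (n : ℕ) : PowerSeries ℤ :=
  (∏ j ∈ range n, (1 + X ^ (2 * (j + 1)))) ^ 2 * X ^ (2 * (n + 1)) * ∏ j ∈ range (n + 1), G ℤ (2 * j + 1)

noncomputable def uterm (q : ℝ) (n : ℕ) : ℝ :=
  (∏ j ∈ Finset.range n, (1 + q ^ 2 * (q ^ 2) ^ j)) ^ 2 * q ^ (2 * (n + 1)) /
    ∏ j ∈ Finset.range (n + 1), (1 - q * (q ^ 2) ^ j)

lemma Rep_gg {q : ℝ} (hq : 0 < q) (hq1 : q < 1) (n : ℕ) : Rep q (gg n) (uterm q n) := by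
  have h1 := Rep_prod hq (fun j => 1 + X ^ (2 * (j + 1))) (fun j => 1 + q ^ (2 * (j + 1)))
    (fun j => Rep_add (Rep_one q) (Rep_X_pow q _)) n
  have h2 := Rep_prod hq (fun j => G ℤ (2 * j + 1)) (fun j => (1 - q ^ (2 * j + 1))⁻¹)
    (fun j => Rep_G hq hq1 _ (by omega)) (n + 1)
  have h3 := Rep_mul hq (Rep_mul hq (Rep_mul hq h1 h1) (Rep_X_pow q (2 * (n + 1)))) h2
  convert h3 using 1
  · rw [gg, sq]
  · rw [uterm, div_eq_mul_inv, sq, ← prod_inv_distrib]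
    congr 1
    · congr 2
      all_goals (apply prod_congr rfl; intro j _; ring)
    · apply prod_congr rfl; intro j _; congr 2; ring

lemma den_pos {q : ℝ} (hq : 0 < q) (hq1 : q < 1) (j : ℕ) : 0 < 1 - q * (q ^ 2) ^ j := by
  have : q * (q ^ 2) ^ j = q ^ (2 * j + 1) := by ring
  rw [this]; have := pow_lt_one₀ hq.le hq1 (n := 2 * j + 1) (by omega); linarith

lemma uterm_pos {q : ℝ} (hq : 0 < q) (hq1 : q < 1) (n : ℕ) : 0 < uterm q n := by
  have := prod_pos (s := range (n + 1)) fun j _ => den_pos hq hq1 j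
  have : 0 < ∏ j ∈ Finset.range n, (1 + q ^ 2 * (q ^ 2) ^ j) := prod_pos fun j _ => by positivity
  rw [uterm]; positivity

lemma uterm_summable {q : ℝ} (hq : 0 < q) (hq1 : q < 1) : Summable (uterm q) := by
  have hpos := uterm_pos hq hq1
  have hr : ∀ n, uterm q (n + 1) / uterm q n =
      (1 + q ^ 2 * (q ^ 2) ^ n) ^ 2 * q ^ 2 / (1 - q * (q ^ 2) ^ (n + 1)) := by
    intro n
    have p1 := prod_pos (s := range (n + 1)) fun j _ => den_pos hq hq1 j
    have p2 := den_pos hq hq1 (n + 1)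
    have p3 : 0 < ∏ j ∈ Finset.range n, (1 + q ^ 2 * (q ^ 2) ^ j) := prod_pos fun j _ => by positivity
    rw [uterm, uterm, prod_range_succ _ (n + 1), prod_range_succ _ n]
    generalize ∏ j ∈ range (n + 1), (1 - q * (q ^ 2) ^ j) = A at *
    generalize ∏ j ∈ Finset.range n, (1 + q ^ 2 * (q ^ 2) ^ j) = B at *
    generalize 1 - q * (q ^ 2) ^ (n + 1) = D at *
    field_simp
    ring
  have hq2 : q ^ 2 < 1 := pow_lt_one₀ hq.le hq1 (by omega)
  have hp : Filter.Tendsto (fun n : ℕ => (q ^ 2) ^ n) Filter.atTop (nhds 0) :=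
    tendsto_pow_atTop_nhds_zero_of_lt_one (by positivity) hq2
  apply summable_of_ratio_test_tendsto_lt_one (l := q ^ 2) hq2
  · exact Filter.Eventually.of_forall fun n => (hpos n).ne'
  · have e : (fun n => ‖uterm q (n + 1)‖ / ‖uterm q n‖) = fun n =>
      (1 + q ^ 2 * (q ^ 2) ^ n) ^ 2 * q ^ 2 / (1 - q * ((q ^ 2) ^ n * q ^ 2)) := by
      funext n
      rw [Real.norm_of_nonneg (hpos _).le, Real.norm_of_nonneg (hpos _).le, hr, pow_succ (q ^ 2) n]
    rw [e]
    have : Filter.Tendsto (fun n : ℕ => (1 + q ^ 2 * (q ^ 2) ^ n) ^ 2 * q ^ 2 / (1 - q * ((q ^ 2) ^ n * q ^ 2)))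
      Filter.atTop (nhds ((1 + q ^ 2 * 0) ^ 2 * q ^ 2 / (1 - q * (0 * q ^ 2)))) := by
      apply Filter.Tendsto.div
      · exact (((hp.const_mul _).const_add _).pow 2).mul_const _
      · exact ((hp.mul_const _).const_mul _).const_sub _
      · simp
    simpa using this

lemma gg_coeff_zero (n M : ℕ) (h : M ≤ n) : coeff M (gg n) = 0 := by
  rw [gg, mul_right_comm, mul_comm _ (X ^ _), coeff_X_pow_mul', if_neg (by omega)]

lemma U2_hasSum {q : ℝ} (hq : 0 < q) (hq1 : q < 1) :
    HasSum (fun M => ((∑ n ∈ range M, coeff M (gg n) : ℤ) : ℝ) * q ^ M) (U2series q) := by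
  have hU : U2series q = ∑' n, uterm q n := rfl
  have hs := uterm_summable hq hq1
  have hR := Rep_gg hq hq1
  let F : ℕ × ℕ → ℝ := fun p => ((coeff p.2 (gg p.1) : ℤ) : ℝ) * q ^ p.2
  have hF0 : 0 ≤ F := fun p => mul_nonneg (Int.cast_nonneg ((hR p.1).1 p.2)) (by positivity)
  have hF : Summable F := by
    rw [summable_prod_of_nonneg hF0]
    refine ⟨fun n => (hR n).2.summable, ?_⟩
    have : (fun n => ∑' i, F (n, i)) = uterm q := by
      funext n; exact (hR n).2.tsum_eq
    rw [this]; exact hs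
  have h1 : HasSum F (U2series q) := by
    have := hF.hasSum.prod_fiberwise fun n => (hR n).2
    rw [hU, this.tsum_eq]; exact hF.hasSum
  have h2 : HasSum (F ∘ Prod.swap) (U2series q) := (Equiv.prodComm ℕ ℕ).hasSum_iff.mpr h1
  refine h2.prod_fiberwise fun M => ?_
  have h0 : ∀ n ∉ range M, (F ∘ Prod.swap) (M, n) = 0 := by
    intro n hn
    simp only [Function.comp, Prod.swap_prod_mk, F]
    rw [gg_coeff_zero n M (by simpa using hn)]; simp
  have e : ((∑ n ∈ range M, coeff M (gg n) : ℤ) : ℝ) * q ^ M = ∑ n ∈ range M, (F ∘ Prod.swap) (M, n) := by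
    simp [F, sum_mul]
  rw [e]
  exact hasSum_sum_of_ne_finset_zero h0

lemma coeff_unique (d : ℕ → ℝ) (h : ∀ q : ℝ, 0 < q → q < 1 → HasSum (fun n => d n * q ^ n) 0) (N : ℕ) :
    d N = 0 := by
  induction N using Nat.strong_induction_on with
  | _ N ih =>
  have hN : ∀ q : ℝ, 0 < q → q < 1 → HasSum (fun i => d (i + N) * q ^ i) 0 := by
    intro q hq hq1
    have h1 := (hasSum_nat_add_iff' (f := fun n => d n * q ^ n) N).mpr (h q hq hq1)
    rw [sum_eq_zero (fun i hi => by rw [ih i (by simpa using hi), zero_mul]), sub_zero] at h1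
    have h2 := h1.mul_left (q ^ N)⁻¹
    rw [mul_zero] at h2
    have e : (fun i => d (i + N) * q ^ i) = fun i => (q ^ N)⁻¹ * (d (i + N) * q ^ (i + N)) := by
      funext i
      rw [pow_add]; field_simp
    rw [e]; exact h2
  have hs : Summable fun i => |d (i + 1 + N) * (1 / 2) ^ i| := by
    have := ((summable_nat_add_iff (f := fun i => d (i + N) * (1 / 2 : ℝ) ^ i) 1).mpr
      (hN (1 / 2) (by norm_num) (by norm_num)).summable).abs
    have := this.mul_left 2
    refine this.congr fun i => ?_
    rw [abs_mul, abs_mul, abs_of_pos (show (0:ℝ) < (1 / 2) ^ (i + 1) by positivity),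
      abs_of_pos (show (0:ℝ) < (1 / 2) ^ i by positivity)]; ring
  set C := ∑' i, |d (i + 1 + N) * (1 / 2) ^ i| with hC
  have key : ∀ q : ℝ, 0 < q → q ≤ 1 / 2 → |d N| ≤ q * C := by
    intro q hq hq2
    have h0 := hN q hq (by linarith)
    have h1 := (hasSum_nat_add_iff' (f := fun i => d (i + N) * q ^ i) 1).mpr h0
    simp only [sum_range_one, zero_add, pow_zero, mul_one, zero_sub] at h1
    have e : |d N| = |∑' i, d (i + 1 + N) * q ^ (i + 1)| := by rw [h1.tsum_eq, abs_neg]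
    rw [e, hC, ← tsum_mul_left]
    have hle : ∀ i, ‖d (i + 1 + N) * q ^ (i + 1)‖ ≤ q * |d (i + 1 + N) * (1 / 2) ^ i| := by
      intro i
      rw [Real.norm_eq_abs, abs_mul, abs_mul, abs_of_pos (show 0 < q ^ (i + 1) by positivity),
        abs_of_pos (show (0:ℝ) < (1 / 2) ^ i by positivity), pow_succ]
      have : q ^ i ≤ (1 / 2) ^ i := by gcongr
      have := mul_le_mul_of_nonneg_left this (mul_nonneg hq.le (abs_nonneg (d (i + 1 + N))))
      linarith
    exact tsum_of_norm_bounded (hs.mul_left q).hasSum hle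
  have hC0 : 0 ≤ C := tsum_nonneg fun i => abs_nonneg _
  by_contra hne
  have hp : 0 < |d N| := abs_pos.mpr hne
  have hq := key (min (1 / 2) (|d N| / (2 * (C + 1)))) (by positivity) (min_le_left _ _)
  have : min (1 / 2) (|d N| / (2 * (C + 1))) * C ≤ |d N| / (2 * (C + 1)) * C := by
    gcongr; exact min_le_right _ _
  have h3 : |d N| / (2 * (C + 1)) * C < |d N| := by
    rw [div_mul_eq_mul_div, div_lt_iff₀ (by positivity)]
    nlinarith
  linarith

lemma map_gg (n : ℕ) : PowerSeries.map (Int.castRingHom (ZMod 2)) (gg n) =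
    PP n ^ 2 * X ^ (2 * (n + 1)) * OG (n + 1) := by
  have hG : ∀ k, PowerSeries.map (Int.castRingHom (ZMod 2)) (G ℤ k) = G (ZMod 2) k := by
    intro k; ext i
    simp only [coeff_map, G, coeff_mk]
    split_ifs <;> simp
  simp only [gg, map_mul, map_pow, map_prod, map_add, map_one, PowerSeries.map_X, hG, PP, OG]
  congr 3
  apply prod_congr rfl
  intro i _
  linear_combination X ^ (2 * (i + 1)) * two_zero

theorem u2_parity (u2 : ℕ → ℤ)
    (h : ∀ q : ℝ, 0 < q → q < 1 →
      HasSum (fun n => (u2 n : ℝ) * q ^ n) (U2series q)) (n : ℕ) :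
    Odd (u2 n) ↔ Odd (hecke n).card := by
  have h1 := coeff_unique (fun M => (u2 M : ℝ) - ((∑ n ∈ range M, coeff M (gg n) : ℤ) : ℝ)) (by
    intro q hq hq1
    have := (h q hq hq1).sub (U2_hasSum hq hq1)
    simpa [sub_mul] using this) n
  have h2 : u2 n = ∑ k ∈ range n, coeff n (gg k) := by exact_mod_cast sub_eq_zero.mp h1
  have h3 : ((u2 n : ℤ) : ZMod 2) = ((hecke n).card : ZMod 2) := by
    rw [← main_F2, h2, map_sum]
    push_cast
    apply sum_congr rfl
    intro k _
    rw [← map_gg, coeff_map]; rfl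
  rw [← ZMod.intCast_eq_one_iff_odd, ← ZMod.natCast_eq_one_iff_odd, h3]

end QS

namespace QS
open Finset

/-- Pairs relevant for the root `t` of `t^2 = 6` modulo `m`. -/
def CC (m t x y : ℤ) : Prop := m ∣ x - t * y ∨ m ∣ x + t * y

lemma CC_neg_x {m t x y : ℤ} (h : CC m t x y) : CC m t (-x) y := by
  rcases h with h | h
  · right; rw [show -x + t * y = -(x - t * y) by ring]; exact dvd_neg.mpr h
  · left; rw [show -x - t * y = -(x + t * y) by ring]; exact dvd_neg.mpr h

lemma CC_neg_y {m t x y : ℤ} (h : CC m t x y) : CC m t x (-y) := by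
  rcases h with h | h
  · right; convert h using 1; ring
  · left; convert h using 1; ring

lemma descent (m t : ℤ) (hm : m % 8 = 7) (hm0 : 0 < m) (ht : m ∣ t ^ 2 - 6) (N : ℕ) :
    ∀ x y : ℤ, y.natAbs = N → x ^ 2 - 6 * y ^ 2 = -m → CC m t x y →
    ∃ x y : ℤ, 0 ≤ x ∧ x < 2 * y ∧ x ^ 2 - 6 * y ^ 2 = -m ∧ CC m t x y := by
  induction N using Nat.strong_induction_on with
  | _ N ih =>
  have pos : ∀ x y : ℤ, y.natAbs = N → x ^ 2 - 6 * y ^ 2 = -m → CC m t x y → 0 ≤ x → 0 ≤ y →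
      ∃ x y : ℤ, 0 ≤ x ∧ x < 2 * y ∧ x ^ 2 - 6 * y ^ 2 = -m ∧ CC m t x y := by
    intro x y hy he hc hx hy0
    by_cases hlt : x < 2 * y
    · exact ⟨x, y, hx, hlt, he, hc⟩
    push Not at hlt
    have hne : x ≠ 2 * y := by
      rintro rfl
      have : m = 2 * y ^ 2 := by linarith [he, show (2 * y) ^ 2 = 4 * y ^ 2 by ring]
      omega
    have h3 : x < 3 * y := by nlinarith
    refine ih _ ?_ (5 * x - 12 * y) (5 * y - 2 * x) rfl ?_ ?_
    · omega
    · rw [← he]; ring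
    · obtain ⟨s, hs⟩ := ht
      rcases hc with ⟨k, hk⟩ | ⟨k, hk⟩
      · left; exact ⟨5 * k + 2 * t * k + 2 * s * y, by linear_combination (5 + 2 * t) * hk + 2 * y * hs⟩
      · right; exact ⟨5 * k - 2 * t * k + 2 * s * y, by linear_combination (5 - 2 * t) * hk + 2 * y * hs⟩
  intro x y hy he hc
  rcases le_total 0 x with hx | hx <;> rcases le_total 0 y with hy0 | hy0
  · exact pos x y hy he hc hx hy0
  · exact pos x (-y) (by simpa using hy) (by simpa using he) (CC_neg_y hc) hx (by omega)
  · exact pos (-x) y hy (by simpa using he) (CC_neg_x hc) (by omega) hy0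
  · exact pos (-x) (-y) (by simpa using hy) (by simpa using he) (CC_neg_y (CC_neg_x hc)) (by omega) (by omega)

lemma thue (m : ℕ) (hm : 0 < m) (t : ℤ) (a b : ℕ) (hab : m < (a + 1) * (b + 1)) :
    ∃ x y : ℤ, (m : ℤ) ∣ x - t * y ∧ |x| ≤ a ∧ |y| ≤ b ∧ (x, y) ≠ (0, 0) := by
  have : NeZero m := ⟨hm.ne'⟩
  obtain ⟨p, q, hne, heq⟩ := Fintype.exists_ne_map_eq_of_card_lt
    (fun p : Fin (a + 1) × Fin (b + 1) => (((p.1 : ℕ) : ℤ) - t * ((p.2 : ℕ) : ℤ) : ℤ) |> (Int.cast : ℤ → ZMod m))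
    (by simpa [ZMod.card] using hab)
  refine ⟨(p.1 : ℕ) - (q.1 : ℕ), (p.2 : ℕ) - (q.2 : ℕ), ?_, ?_, ?_, ?_⟩
  · have := (ZMod.intCast_eq_intCast_iff_dvd_sub _ _ _).mp heq
    rw [← dvd_neg] at this
    refine this.trans (dvd_of_eq ?_)
    ring
  · have := p.1.2; have := q.1.2; rw [abs_le]; constructor <;> omega
  · have := p.2.2; have := q.2.2; rw [abs_le]; constructor <;> omega
  · intro h
    simp only [Prod.mk.injEq] at h
    apply hne
    ext
    · omega
    · omega

lemma no_mod8_sq {x : ℤ} : x ^ 2 % 8 = 0 ∨ x ^ 2 % 8 = 1 ∨ x ^ 2 % 8 = 4 := by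
  have h : x % 8 = 0 ∨ x % 8 = 1 ∨ x % 8 = 2 ∨ x % 8 = 3 ∨ x % 8 = 4 ∨ x % 8 = 5 ∨ x % 8 = 6 ∨ x % 8 = 7 := by omega
  rcases h with h | h | h | h | h | h | h | h <;> simp [pow_two, Int.mul_emod, h]

lemma exists_pair (m : ℕ) (hm : m % 8 = 7) (t : ℤ) (ht : (m : ℤ) ∣ t ^ 2 - 6) :
    ∃ x y : ℤ, x ^ 2 - 6 * y ^ 2 = -m ∧ CC m t x y := by
  obtain ⟨x, y, hd, hx, hy, hne⟩ := thue m (by omega) t (Nat.sqrt (3 * m)) (Nat.sqrt (m / 2)) (by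
    have h1 := Nat.lt_succ_sqrt (3 * m)
    have h2 := Nat.lt_succ_sqrt (m / 2)
    simp only [Nat.succ_eq_add_one] at h1 h2
    generalize (3 * m).sqrt + 1 = A at *
    generalize (m / 2).sqrt + 1 = B at *
    have h3 : m ≤ 2 * (B * B) := by omega
    by_contra hc
    push Not at hc
    have : (A * B) * (A * B) ≤ m * m := Nat.mul_le_mul hc hc
    have h4 : (3 * m + 1) * m ≤ (A * A) * (2 * (B * B)) := Nat.mul_le_mul h1 h3
    have h5 : (A * A) * (2 * (B * B)) = 2 * ((A * B) * (A * B)) := by ring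
    have h6 : (3 * m + 1) * m = 3 * (m * m) + m := by ring
    have h7 : 0 < m := by omega
    have h8 : 0 < m * m := by positivity
    omega)
  have hx2 : x ^ 2 ≤ 3 * m := by
    have h1 : ((Nat.sqrt (3 * m) : ℕ) : ℤ) * (Nat.sqrt (3 * m) : ℕ) ≤ 3 * m := by exact_mod_cast Nat.sqrt_le (3 * m)
    rw [← sq_abs]; nlinarith [abs_nonneg x]
  have hy2 : 2 * y ^ 2 ≤ m := by
    have h1 : ((Nat.sqrt (m / 2) : ℕ) : ℤ) * (Nat.sqrt (m / 2) : ℕ) ≤ (m / 2 : ℕ) := by exact_mod_cast Nat.sqrt_le (m / 2)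
    have h2 : 2 * ((m / 2 : ℕ) : ℤ) ≤ m := by omega
    rw [← sq_abs y]; nlinarith [abs_nonneg y]
  have hm0 : (0 : ℤ) < m := by omega
  have hm8 : (m : ℤ) % 8 = 7 := by omega
  obtain ⟨s, hs⟩ := ht
  obtain ⟨k, hk⟩ : (m : ℤ) ∣ x ^ 2 - 6 * y ^ 2 := by
    obtain ⟨c, hc⟩ := hd
    exact ⟨c * (x + t * y) + s * y ^ 2, by linear_combination (x + t * y) * hc + y ^ 2 * hs⟩
  have hx0 := sq_nonneg x
  have hy0 := sq_nonneg y
  have k1 : k ≤ 3 := by nlinarith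
  have k2 : -3 ≤ k := by nlinarith
  have ex := @no_mod8_sq x
  have ey := @no_mod8_sq y
  have hk' : k = -3 ∨ k = -2 ∨ k = -1 ∨ k = 0 ∨ k = 1 ∨ k = 2 ∨ k = 3 := by omega
  rcases hk' with rfl | rfl | rfl | rfl | rfl | rfl | rfl
  · omega
  · exfalso
    obtain ⟨z, rfl⟩ : ∃ z, x = 2 * z := by
      have : Even (x ^ 2) := by rw [Int.even_iff]; omega
      obtain ⟨z, hz⟩ := (Int.even_pow.mp this).1
      exact ⟨z, by omega⟩
    have ez := @no_mod8_sq z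
    have : (2 * z) ^ 2 = 4 * z ^ 2 := by ring
    omega
  · exact ⟨x, y, by linarith, Or.inl hd⟩
  · exfalso
    have hxy : x ^ 2 = 6 * y ^ 2 := by linarith
    -- infinite descent through irrationality of sqrt 6
    have hy' : y ≠ 0 := by
      rintro rfl
      have : x = 0 := by simpa using hxy
      exact hne (by simp [this])
    have h6 : IsSquare (6 : ℚ) := ⟨x / y, by
      have : (y : ℚ) ≠ 0 := by exact_mod_cast hy'
      have h : (x : ℚ) ^ 2 = 6 * y ^ 2 := by exact_mod_cast hxy
      field_simp; linarith⟩
    have : IsSquare (6 : ℤ) := by exact_mod_cast (Rat.isSquare_intCast_iff (z := 6)).mp (by exact_mod_cast h6)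
    obtain ⟨r, hr⟩ := this
    have : r ^ 2 = 6 := by linarith
    have := @no_mod8_sq r
    omega
  · omega
  · obtain ⟨z, rfl⟩ : ∃ z, x = 2 * z := by
      have : Even (x ^ 2) := by rw [Int.even_iff]; omega
      obtain ⟨z, hz⟩ := (Int.even_pow.mp this).1
      exact ⟨z, by omega⟩
    refine ⟨2 * z + 3 * y, y + z, by linarith [show (2 * z) ^ 2 = 4 * z ^ 2 by ring, show (2 * z + 3 * y) ^ 2 - 6 * (y + z) ^ 2 = 3 * y ^ 2 - 2 * z ^ 2 by ring], Or.inl ?_⟩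
    have h2 : (m : ℤ) ∣ 2 * (2 * z + 3 * y - t * (y + z)) := by
      obtain ⟨c, hc⟩ := hd
      exact ⟨2 * c - t * c - s * y, by linear_combination (2 - t) * hc - y * hs⟩
    have hcop : IsCoprime (m : ℤ) 2 := by
      refine ⟨1, -((m : ℤ) / 2), by omega⟩
    exact hcop.dvd_of_dvd_mul_left h2
  · omega

end QS

namespace QS
open Finset

def DD (m : ℕ) : Finset (ℕ × ℕ) :=
  (range (2 * m + 1) ×ˢ range (m + 1)).filter fun p => p.1 < 2 * p.2 ∧ p.1 ^ 2 + m = 6 * p.2 ^ 2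

def Dp (m : ℕ) : Finset (ℕ × ℕ) := (DD m).filter fun p => Nat.Coprime p.1 p.2

lemma mem_DD (m : ℕ) (p : ℕ × ℕ) : p ∈ DD m ↔ p.1 < 2 * p.2 ∧ p.1 ^ 2 + m = 6 * p.2 ^ 2 := by
  rw [DD, mem_filter, mem_product, mem_range, mem_range]
  refine ⟨fun h => h.2, fun h => ⟨?_, h⟩⟩
  obtain ⟨h1, h2⟩ := h
  have h3 : p.1 ^ 2 ≤ 4 * p.2 ^ 2 := by
    have := Nat.mul_le_mul h1.le h1.le
    calc p.1 ^ 2 = p.1 * p.1 := by ring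
      _ ≤ _ := this
      _ = _ := by ring
  have h4 : p.2 ≤ p.2 ^ 2 := Nat.le_self_pow (by norm_num) _
  omega

lemma mem_Dp (m : ℕ) (p : ℕ × ℕ) : p ∈ Dp m ↔ (p.1 < 2 * p.2 ∧ p.1 ^ 2 + m = 6 * p.2 ^ 2) ∧ Nat.Coprime p.1 p.2 := by
  rw [Dp, mem_filter, mem_DD]

lemma root_surj (m : ℕ) (hm : m % 8 = 7) (t : ℤ) (ht : (m : ℤ) ∣ t ^ 2 - 6) :
    ∃ p ∈ Dp m, CC m t p.1 p.2 := by
  obtain ⟨x0, y0, he0, hc0⟩ := exists_pair m hm t ht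
  obtain ⟨x, y, hx, hlt, he, hc⟩ := descent m t (by omega) (by omega) ht _ x0 y0 rfl he0 hc0
  lift x to ℕ using hx
  lift y to ℕ using (by omega)
  refine ⟨(x, y), ?_, hc⟩
  rw [mem_Dp]
  have hmm : (m : ℤ) ≠ 0 := by omega
  refine ⟨⟨by simp only; omega, ?_⟩, ?_⟩
  · zify; linarith
  · rw [Nat.coprime_iff_gcd_eq_one]
    by_contra hne
    obtain ⟨p, hp, hpd⟩ := Nat.exists_prime_and_dvd hne
    have hpx : (p : ℤ) ∣ x := by exact_mod_cast hpd.trans (Nat.gcd_dvd_left _ _)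
    have hpy : (p : ℤ) ∣ y := by exact_mod_cast hpd.trans (Nat.gcd_dvd_right _ _)
    have hpm : (p : ℤ) ∣ m := by
      have : (m : ℤ) = 6 * (y : ℤ) ^ 2 - (x : ℤ) ^ 2 := by linarith
      rw [this]
      exact dvd_sub (Dvd.dvd.mul_left (dvd_pow hpy (by norm_num)) _) (dvd_pow hpx (by norm_num))
    obtain ⟨s, hs⟩ := ht
    have key : (p : ℤ) ∣ 1 := by
      rcases hc with ⟨k, hk⟩ | ⟨k, hk⟩
      · have : (m : ℤ) * (s * y ^ 2 + 2 * t * y * k + m * k ^ 2) = m * (-1) := by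
          have hx : (x : ℤ) = t * y + m * k := by linarith
          rw [hx] at he
          linear_combination he - y ^ 2 * hs
        have h1 := mul_left_cancel₀ hmm this
        have h2 : (1 : ℤ) = -(s * y ^ 2 + 2 * t * y * k + m * k ^ 2) := by linarith
        rw [h2, dvd_neg]
        refine dvd_add (dvd_add ?_ ?_) (Dvd.dvd.mul_right hpm _)
        · exact Dvd.dvd.mul_left (dvd_pow hpy (by norm_num)) _
        · exact Dvd.dvd.mul_right (Dvd.dvd.mul_left hpy _) _
      · have : (m : ℤ) * (s * y ^ 2 - 2 * t * y * k + m * k ^ 2) = m * (-1) := by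
          have hx : (x : ℤ) = - t * y + m * k := by linarith
          rw [hx] at he
          linear_combination he - y ^ 2 * hs
        have h1 := mul_left_cancel₀ hmm this
        have h2 : (1 : ℤ) = -(s * y ^ 2 - 2 * t * y * k + m * k ^ 2) := by linarith
        rw [h2, dvd_neg]
        refine dvd_add (dvd_sub ?_ ?_) (Dvd.dvd.mul_right hpm _)
        · exact Dvd.dvd.mul_left (dvd_pow hpy (by norm_num)) _
        · exact Dvd.dvd.mul_right (Dvd.dvd.mul_left hpy _) _
    have := Int.eq_one_of_dvd_one (by omega) key
    exact hp.one_lt.ne' (by exact_mod_cast this)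

lemma two_yy (m x y x' y' : ℤ) (hx : 0 ≤ x) (hx' : 0 ≤ x') (h : x < 2 * y) (h' : x' < 2 * y')
    (e : x ^ 2 + m = 6 * y ^ 2) (e' : x' ^ 2 + m = 6 * y' ^ 2) : 2 * (y * y') < m := by
  have h1 : 2 * y ^ 2 < m := by nlinarith
  have h2 : 2 * y' ^ 2 < m := by nlinarith
  nlinarith [sq_nonneg (y - y')]

lemma Dp_inj (m : ℕ) (p p' : ℕ × ℕ) (hp : p ∈ Dp m) (hp' : p' ∈ Dp m)
    (hd : (m : ℤ) ∣ p.1 * p'.2 - p'.1 * p.2) : p = p' := by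
  rw [mem_Dp] at hp hp'
  obtain ⟨x, y⟩ := p
  obtain ⟨x', y'⟩ := p'
  simp only at *
  obtain ⟨⟨h, e⟩, c⟩ := hp
  obtain ⟨⟨h', e'⟩, c'⟩ := hp'
  have hb := two_yy m x y x' y' (by omega) (by omega) (by omega) (by omega) (by exact_mod_cast e) (by exact_mod_cast e')
  have h1 : (x : ℤ) * y' ≤ 2 * (y * y') := by
    have : (x : ℤ) ≤ 2 * y := by omega
    nlinarith
  have h2 : (x' : ℤ) * y ≤ 2 * (y * y') := by
    have : (x' : ℤ) ≤ 2 * y' := by omega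
    nlinarith
  have h3 : (0 : ℤ) ≤ x * y' := by positivity
  have h4 : (0 : ℤ) ≤ x' * y := by positivity
  have h5 : (x : ℤ) * y' - x' * y = 0 := by
    apply Int.eq_zero_of_abs_lt_dvd hd
    rw [abs_lt]; constructor <;> linarith
  have h6 : x * y' = x' * y := by zify; linarith
  have a1 : x ∣ x' := c.dvd_of_dvd_mul_right (Dvd.intro _ h6)
  have a2 : x' ∣ x := c'.dvd_of_dvd_mul_right (Dvd.intro _ h6.symm)
  have a3 : x = x' := Nat.dvd_antisymm a1 a2
  have a4 : y ∣ y' := c.symm.dvd_of_dvd_mul_left (Dvd.intro_left _ h6.symm)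
  have a5 : y' ∣ y := c'.symm.dvd_of_dvd_mul_left (Dvd.intro_left _ h6)
  rw [a3, Nat.dvd_antisymm a4 a5]

lemma Dp_no (m : ℕ) (hm : m % 8 = 7) (p p' : ℕ × ℕ) (hp : p ∈ Dp m) (hp' : p' ∈ Dp m)
    (hd : (m : ℤ) ∣ p.1 * p'.2 + p'.1 * p.2) : False := by
  rw [mem_Dp] at hp hp'
  obtain ⟨x, y⟩ := p
  obtain ⟨x', y'⟩ := p'
  simp only at *
  obtain ⟨⟨h, e⟩, c⟩ := hp
  obtain ⟨⟨h', e'⟩, c'⟩ := hp'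
  have hb := two_yy m x y x' y' (by omega) (by omega) (by omega) (by omega) (by exact_mod_cast e) (by exact_mod_cast e')
  have hy : (0 : ℤ) < y := by omega
  have hy' : (0 : ℤ) < y' := by omega
  have h1 : (x : ℤ) * y' < 2 * (y * y') := by
    have : (x : ℤ) < 2 * y := by omega
    nlinarith
  have h2 : (x' : ℤ) * y < 2 * (y * y') := by
    have : (x' : ℤ) < 2 * y' := by omega
    nlinarith
  have hx0 : x ≠ 0 := by rintro rfl; omega
  have h3 : (0 : ℤ) < x * y' := by positivity
  have h4 : (0 : ℤ) ≤ x' * y := by positivity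
  have hm0 : (0 : ℤ) < m := by omega
  obtain ⟨v, hv⟩ := hd
  have v1 : v = 1 := by
    have : 0 < v := by nlinarith
    have : v < 2 := by nlinarith
    omega
  rw [v1, mul_one] at hv
  have E : (x : ℤ) ^ 2 + m = 6 * y ^ 2 := by exact_mod_cast e
  have E' : (x' : ℤ) ^ 2 + m = 6 * y' ^ 2 := by exact_mod_cast e'
  have key : ((x : ℤ) * x' + 6 * y * y') ^ 2 = 7 * (m : ℤ) ^ 2 := by
    have z1 : (x : ℤ) ^ 2 - 6 * y ^ 2 = -m := by linarith
    have z2 : (x' : ℤ) ^ 2 - 6 * y' ^ 2 = -m := by linarith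
    have : ((x : ℤ) ^ 2 - 6 * y ^ 2) * ((x' : ℤ) ^ 2 - 6 * y' ^ 2) = m ^ 2 := by rw [z1, z2]; ring
    have hv2 : ((x : ℤ) * y' + x' * y) ^ 2 = m ^ 2 := by rw [hv]
    linear_combination this + 6 * hv2
  have h8 := @no_mod8_sq ((x : ℤ) * x' + 6 * y * y')
  have : (m : ℤ) ^ 2 % 8 = 1 := by
    have : (m : ℤ) % 8 = 7 := by omega
    simp [pow_two, Int.mul_emod, this]
  omega

/-- Square roots of six modulo `m`. -/
abbrev Rt (m : ℕ) := {t : ZMod m // t ^ 2 = 6}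

lemma Dp_unit {m : ℕ} {p : ℕ × ℕ} (hp : p ∈ Dp m) : (p.2 : ZMod m) * (p.2 : ZMod m)⁻¹ = 1 := by
  apply ZMod.coe_mul_inv_eq_one
  rw [mem_Dp] at hp
  obtain ⟨⟨h, e⟩, c⟩ := hp
  rw [Nat.coprime_iff_gcd_eq_one]
  by_contra hne
  obtain ⟨q, hq, hqd⟩ := Nat.exists_prime_and_dvd hne
  have h1 := hqd.trans (Nat.gcd_dvd_left _ _)
  have h2 := hqd.trans (Nat.gcd_dvd_right _ _)
  have h3 : q ∣ p.1 ^ 2 := by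
    rw [Nat.dvd_add_iff_left h2, e]
    exact Dvd.dvd.mul_left (dvd_pow h1 (by norm_num)) _
  have := Nat.dvd_gcd (hq.dvd_of_dvd_pow h3) h1
  rw [c] at this
  exact hq.one_lt.ne' (Nat.dvd_one.mp this)

lemma Dp_sq {m : ℕ} {p : ℕ × ℕ} (hp : p ∈ Dp m) : ((p.1 : ZMod m) * (p.2 : ZMod m)⁻¹) ^ 2 = 6 := by
  have hu := Dp_unit hp
  rw [mem_Dp] at hp
  have := congrArg (Nat.cast (R := ZMod m)) hp.1.2
  push_cast at this
  rw [ZMod.natCast_self, add_zero] at this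
  rw [mul_pow, this]
  linear_combination (6 * ((p.2 : ZMod m) * (p.2 : ZMod m)⁻¹) + 6) * hu

lemma card_Rt (m : ℕ) (hm : m % 8 = 7) : Nat.card (Rt m) = 2 * (Dp m).card := by
  have hm0 : NeZero m := ⟨by omega⟩
  let f : (Dp m) × Bool → Rt m := fun z =>
    if z.2 then ⟨(z.1.1.1 : ZMod m) * (z.1.1.2 : ZMod m)⁻¹, Dp_sq z.1.2⟩
    else ⟨-((z.1.1.1 : ZMod m) * (z.1.1.2 : ZMod m)⁻¹), by rw [neg_sq]; exact Dp_sq z.1.2⟩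
  have hsub : ∀ p ∈ Dp m, ∀ p' ∈ Dp m, (p.1 : ZMod m) * (p.2 : ZMod m)⁻¹ = (p'.1 : ZMod m) * (p'.2 : ZMod m)⁻¹ → p = p' := by
    intro p hp p' hp' h
    apply Dp_inj m p p' hp hp'
    rw [← ZMod.intCast_zmod_eq_zero_iff_dvd]
    push_cast
    have h1 := Dp_unit hp
    have h2 := Dp_unit hp'
    linear_combination (p.2 * p'.2 : ZMod m) * h - (p.1 * p'.2 : ZMod m) * h1 + (p'.1 * p.2 : ZMod m) * h2
  have hadd : ∀ p ∈ Dp m, ∀ p' ∈ Dp m, (p.1 : ZMod m) * (p.2 : ZMod m)⁻¹ = -((p'.1 : ZMod m) * (p'.2 : ZMod m)⁻¹) → False := by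
    intro p hp p' hp' h
    apply Dp_no m hm p p' hp hp'
    rw [← ZMod.intCast_zmod_eq_zero_iff_dvd]
    push_cast
    have h1 := Dp_unit hp
    have h2 := Dp_unit hp'
    linear_combination (p.2 * p'.2 : ZMod m) * h - (p.1 * p'.2 : ZMod m) * h1 - (p'.1 * p.2 : ZMod m) * h2
  have hf : Function.Bijective f := by
    constructor
    · rintro ⟨⟨p, hp⟩, b⟩ ⟨⟨p', hp'⟩, b'⟩ h
      have h := congrArg Subtype.val h
      cases b <;> cases b' <;> simp only [f, if_true, if_false, Bool.false_eq_true] at h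
      · have := hsub p hp p' hp' (neg_injective h)
        subst this; rfl
      · exact (hadd p' hp' p hp h.symm).elim
      · exact (hadd p hp p' hp' h).elim
      · have := hsub p hp p' hp' h
        subst this; rfl
    · rintro ⟨t, ht⟩
      obtain ⟨s, rfl⟩ := ZMod.intCast_surjective t
      have hs : (m : ℤ) ∣ s ^ 2 - 6 := by
        rw [← ZMod.intCast_zmod_eq_zero_iff_dvd]; push_cast; rw [ht]; ring
      obtain ⟨p, hp, hc⟩ := root_surj m hm s hs
      have hu := Dp_unit hp
      rcases hc with hc | hc
      · refine ⟨(⟨p, hp⟩, true), Subtype.ext ?_⟩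
        simp only [f, if_true]
        rw [← ZMod.intCast_zmod_eq_zero_iff_dvd] at hc
        push_cast at hc
        linear_combination ((p.2 : ZMod m)⁻¹) * hc + (s : ZMod m) * hu
      · refine ⟨(⟨p, hp⟩, false), Subtype.ext ?_⟩
        simp only [f, if_false, Bool.false_eq_true]
        rw [← ZMod.intCast_zmod_eq_zero_iff_dvd] at hc
        push_cast at hc
        linear_combination (-(p.2 : ZMod m)⁻¹) * hc + (s : ZMod m) * hu
  rw [← Nat.card_eq_of_bijective f hf]
  simp [Nat.card_eq_fintype_card, mul_comm]

end QS

namespace QS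
open Finset

def Good (m : ℕ) : Prop := ∃ p k e : ℕ, p.Prime ∧ (p % 24 = 5 ∨ p % 24 = 23) ∧ e ≤ 1 ∧ k % 2 = 1 ∧ m = 3 ^ e * p ^ k

lemma even_Rt (b : ℕ) (hb : b % 2 = 1) (h3 : ¬ b ∣ 3) : Even (Nat.card (Rt b)) := by
  have hb0 : NeZero b := ⟨by omega⟩
  have h := Finset.sum_involution (s := (univ : Finset (Rt b))) (f := fun _ => (1 : ZMod 2))
    (fun t _ => ⟨-t.1, by rw [neg_sq]; exact t.2⟩) (fun _ _ => by decide)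
    (fun t _ _ h => by
      have h1 : -t.1 = t.1 := congrArg Subtype.val h
      have h2 : (2 : ZMod b) * t.1 = 0 := by linear_combination -h1
      have h4 : ((24 : ℕ) : ZMod b) = 0 := by
        have := t.2
        push_cast
        linear_combination (2 * t.1) * h2 - 4 * this
      rw [ZMod.natCast_eq_zero_iff] at h4
      apply h3
      have hc : Nat.Coprime b (2 ^ 3) := by
        apply Nat.Coprime.pow_right
        exact Nat.coprime_two_right.mpr (Nat.odd_iff.mpr hb)
      exact hc.dvd_of_dvd_mul_right (show b ∣ 3 * 2 ^ 3 from h4))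
    (fun _ _ => mem_univ _) (fun t _ => by ext; simp)
  rw [sum_const, nsmul_eq_mul, mul_one, card_univ, ZMod.natCast_eq_zero_iff] at h
  rw [Nat.card_eq_fintype_card]
  exact even_iff_two_dvd.mpr h

lemma Rt_mul (a b : ℕ) (h : Nat.Coprime a b) : Nat.card (Rt (a * b)) = Nat.card (Rt a) * Nat.card (Rt b) := by
  rw [← Nat.card_prod]
  let e := ZMod.chineseRemainder h
  have e6 : e 6 = 6 := map_ofNat e 6
  refine Nat.card_congr
    { toFun := fun t => (⟨(e t.1).1, ?_⟩, ⟨(e t.1).2, ?_⟩)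
      invFun := fun z => ⟨e.symm (z.1.1, z.2.1), ?_⟩
      left_inv := ?_
      right_inv := ?_ }
  · have := congrArg (fun z => (e z).1) t.2
    simpa [e6] using this
  · have := congrArg (fun z => (e z).2) t.2
    simpa [e6] using this
  · apply e.injective
    rw [map_pow, RingEquiv.apply_symm_apply, e6]
    ext
    · simpa using z.1.2
    · simpa using z.2.2
  · intro t; ext; simp
  · rintro ⟨⟨s, hs⟩, ⟨t, ht⟩⟩; simp

lemma mod24 (p : ℕ) (hp : p.Prime) (h2 : p ≠ 2) (h3 : p ≠ 3) (t : ℤ) (ht : (p : ℤ) ∣ t ^ 2 - 6) :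
    p % 24 = 1 ∨ p % 24 = 5 ∨ p % 24 = 19 ∨ p % 24 = 23 := by
  have := Fact.mk hp
  have hodd : Odd p := hp.odd_of_ne_two h2
  have h6 : ((6 : ℤ) : ZMod p) ≠ 0 := by
    intro h
    rw [ZMod.intCast_zmod_eq_zero_iff_dvd] at h
    have : p ∣ 2 * 3 := by exact_mod_cast h
    rcases (hp.dvd_mul).mp this with h | h
    · exact h2 ((Nat.prime_dvd_prime_iff_eq hp Nat.prime_two).mp h)
    · exact h3 ((Nat.prime_dvd_prime_iff_eq hp Nat.prime_three).mp h)
  have hl : legendreSym p 6 = 1 := by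
    rw [legendreSym.eq_one_iff p h6]
    refine ⟨(t : ZMod p), ?_⟩
    rw [← ZMod.intCast_zmod_eq_zero_iff_dvd] at ht
    push_cast at ht ⊢
    linear_combination -ht
  rw [jacobiSym.legendreSym.to_jacobiSym, jacobiSym.mod_right 6 hodd] at hl
  have e : 4 * (6 : ℤ).natAbs = 24 := by decide
  rw [e] at hl
  have n3 : p % 3 ≠ 0 := fun h => h3 ((Nat.prime_dvd_prime_iff_eq Nat.prime_three hp).mp (Nat.dvd_of_mod_eq_zero h)).symm
  have n2 : p % 2 = 1 := Nat.odd_iff.mp hodd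
  have hc : p % 24 = 1 ∨ p % 24 = 5 ∨ p % 24 = 7 ∨ p % 24 = 11 ∨ p % 24 = 13 ∨ p % 24 = 17 ∨ p % 24 = 19 ∨ p % 24 = 23 := by omega
  rcases hc with h | h | h | h | h | h | h | h <;> rw [h] at hl <;> first | omega | (norm_num at hl)

lemma pow_mod8 (p k : ℕ) (hp : p % 2 = 1) : p ^ k % 8 = if k % 2 = 0 then 1 else p % 8 := by
  have hsq : p ^ 2 % 8 = 1 := by
    have : p % 8 = 1 ∨ p % 8 = 3 ∨ p % 8 = 5 ∨ p % 8 = 7 := by omega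
    rcases this with h | h | h | h <;> simp [pow_two, Nat.mul_mod, h]
  have hsqk : ∀ j, (p ^ 2) ^ j % 8 = 1 := by
    intro j; rw [Nat.pow_mod, hsq]; simp
  rcases Nat.even_or_odd' k with ⟨j, rfl | rfl⟩
  · rw [pow_mul, hsqk]; simp
  · rw [pow_succ, pow_mul, Nat.mul_mod, hsqk, if_neg (by omega)]; simp

lemma odd_Good (m : ℕ) (hm : m % 8 = 7) (h : Odd (Dp m).card) : Good m := by
  have hcard := card_Rt m hm
  have hm0 : NeZero m := ⟨by omega⟩
  have hne : Nonempty (Rt m) := by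
    rw [← not_isEmpty_iff]; intro hE
    rw [Nat.card_of_isEmpty] at hcard
    rw [Nat.odd_iff] at h; omega
  obtain ⟨t0, ht0⟩ := hne
  obtain ⟨t, rfl⟩ := ZMod.intCast_surjective t0
  have ht : (m : ℤ) ∣ t ^ 2 - 6 := by
    rw [← ZMod.intCast_zmod_eq_zero_iff_dvd]; push_cast; rw [ht0]; ring
  have h9 : ¬ 9 ∣ m := by
    intro h9
    have h9' : (9 : ℤ) ∣ t ^ 2 - 6 := (by exact_mod_cast h9 : (9 : ℤ) ∣ m).trans ht
    have : t % 9 = 0 ∨ t % 9 = 1 ∨ t % 9 = 2 ∨ t % 9 = 3 ∨ t % 9 = 4 ∨ t % 9 = 5 ∨ t % 9 = 6 ∨ t % 9 = 7 ∨ t % 9 = 8 := by omega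
    have h10 : t ^ 2 % 9 = 6 := by omega
    rcases this with h | h | h | h | h | h | h | h | h <;> simp [pow_two, Int.mul_emod, h] at h10
  -- a prime factor different from three
  obtain ⟨p, hp, hp3, hpm⟩ : ∃ p, p.Prime ∧ p ≠ 3 ∧ p ∣ m := by
    by_cases h3 : 3 ∣ m
    · obtain ⟨a, rfl⟩ := h3
      obtain ⟨p, hp, hpa⟩ := Nat.exists_prime_and_dvd (n := a) (by omega)
      refine ⟨p, hp, ?_, Dvd.dvd.mul_left hpa _⟩
      rintro rfl
      exact h9 (by obtain ⟨b, rfl⟩ := hpa; exact ⟨b, by ring⟩)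
    · obtain ⟨p, hp, hpa⟩ := Nat.exists_prime_and_dvd (n := m) (by omega)
      exact ⟨p, hp, by rintro rfl; exact h3 hpa, hpa⟩
  have hp2 : p ≠ 2 := by rintro rfl; omega
  have h24 := mod24 p hp hp2 hp3 t ((by exact_mod_cast hpm : (p : ℤ) ∣ m).trans ht)
  obtain ⟨k, a, hpa, hmka⟩ := Nat.exists_eq_pow_mul_and_not_dvd (n := m) (by omega) p hp.ne_one
  have hk : k ≠ 0 := by rintro rfl; rw [pow_zero, one_mul] at hmka; exact hpa (hmka ▸ hpm)
  have hpk2 : p ^ k % 2 = 1 := by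
    rw [← Nat.odd_iff]; exact (hp.odd_of_ne_two hp2).pow
  have ha2 : a % 2 = 1 := by
    by_contra hh
    have : p ^ k * a % 2 = 0 := by rw [Nat.mul_mod, show a % 2 = 0 by omega]; simp
    omega
  have ha3 : a ∣ 3 := by
    by_contra ha3
    have e1 := even_Rt a ha2 ha3
    have e2 := even_Rt (p ^ k) hpk2 (fun hd => by
      have : p ∣ 3 := (dvd_pow_self p hk).trans hd
      exact hp3 ((Nat.prime_dvd_prime_iff_eq hp Nat.prime_three).mp this))
    have hcop : Nat.Coprime (p ^ k) a := Nat.Coprime.pow_left _ ((Nat.Prime.coprime_iff_not_dvd hp).mpr hpa)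
    rw [hmka, Rt_mul _ _ hcop, ← hmka] at hcard
    obtain ⟨u, hu⟩ := e1
    obtain ⟨v, hv⟩ := e2
    rw [hu, hv] at hcard
    have : (v + v) * (u + u) = 4 * (v * u) := by ring
    rw [Nat.odd_iff] at h
    omega
  have ha : a = 1 ∨ a = 3 := (Nat.dvd_prime Nat.prime_three).mp ha3
  have h8 := pow_mod8 p k (by omega)
  have hm8 : p ^ k * a % 8 = 7 := by rw [← hmka]; exact hm
  have hkk : k % 2 = 1 ∧ (p % 24 = 5 ∨ p % 24 = 23) := by
    split_ifs at h8 with hh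
    · rcases ha with rfl | rfl <;> omega
    · refine ⟨by omega, ?_⟩
      rcases ha with rfl | rfl <;> omega
  rcases ha with rfl | rfl
  · exact ⟨p, k, 0, hp, hkk.2, by omega, hkk.1, by rw [hmka]; ring⟩
  · exact ⟨p, k, 1, hp, hkk.2, by omega, hkk.1, by rw [hmka]; ring⟩

lemma exists_root (p : ℕ) (hp : p.Prime) (h24 : p % 24 = 5 ∨ p % 24 = 23) (k : ℕ) :
    ∃ t : ℤ, (p : ℤ) ^ (k + 1) ∣ t ^ 2 - 6 := by
  have := Fact.mk hp
  have hodd : Odd p := Nat.odd_iff.mpr (by omega)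
  have hn : ¬ (p : ℤ) ∣ 12 := by
    intro h
    have h' : p ∣ 2 ^ 2 * 3 := by exact_mod_cast h
    rcases (hp.dvd_mul).mp h' with h | h
    · have := (Nat.prime_dvd_prime_iff_eq hp Nat.prime_two).mp (hp.dvd_of_dvd_pow h); omega
    · have := (Nat.prime_dvd_prime_iff_eq hp Nat.prime_three).mp h; omega
  have hprime : Prime (p : ℤ) := Nat.prime_iff_prime_int.mp hp
  induction k with
  | zero =>
    have h6 : ((6 : ℤ) : ZMod p) ≠ 0 := by
      intro h
      rw [ZMod.intCast_zmod_eq_zero_iff_dvd] at h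
      exact hn (h.trans (by norm_num))
    have hl : legendreSym p 6 = 1 := by
      rw [jacobiSym.legendreSym.to_jacobiSym, jacobiSym.mod_right 6 hodd]
      have e : 4 * (6 : ℤ).natAbs = 24 := by decide
      rw [e]
      rcases h24 with h | h <;> rw [h] <;> norm_num
    rw [legendreSym.eq_one_iff p h6] at hl
    obtain ⟨r, hr⟩ := hl
    obtain ⟨t, rfl⟩ := ZMod.intCast_surjective r
    refine ⟨t, ?_⟩
    rw [zero_add, pow_one, ← ZMod.intCast_zmod_eq_zero_iff_dvd]
    push_cast at hr ⊢
    linear_combination -hr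
  | succ k ih =>
    obtain ⟨t, s, hs⟩ := ih
    have hpt : ¬ (p : ℤ) ∣ 2 * t := by
      intro h
      apply hn
      have h1 : (p : ℤ) ∣ (2 * t) * t - 2 * (t ^ 2 - 6) := by
        apply dvd_sub (Dvd.dvd.mul_right h _)
        rw [hs]
        exact Dvd.dvd.mul_left (Dvd.dvd.mul_right (dvd_pow_self _ (by omega)) _) _
      rwa [show (2 * t) * t - 2 * (t ^ 2 - 6) = 12 by ring] at h1
    obtain ⟨a, b, hab⟩ := (hprime.coprime_iff_not_dvd).mpr hpt
    -- a * p + b * (2 t) = 1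
    refine ⟨t - s * b * p ^ (k + 1), s * a + s ^ 2 * b ^ 2 * p ^ k, ?_⟩
    linear_combination hs - s * (p : ℤ) ^ (k + 1) * hab

lemma Good_odd (m : ℕ) (hm : m % 8 = 7) (h : Good m) : Odd (Dp m).card := by
  obtain ⟨p, k, e, hp, h24, he, hk, rfl⟩ := h
  have hprime : Prime (p : ℤ) := Nat.prime_iff_prime_int.mp hp
  obtain ⟨j, rfl⟩ : ∃ j, k = j + 1 := ⟨k - 1, by omega⟩
  have hn : ¬ (p : ℤ) ∣ 12 := by
    intro h
    have h' : p ∣ 2 ^ 2 * 3 := by exact_mod_cast h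
    rcases (hp.dvd_mul).mp h' with h | h
    · have := (Nat.prime_dvd_prime_iff_eq hp Nat.prime_two).mp (hp.dvd_of_dvd_pow h); omega
    · have := (Nat.prime_dvd_prime_iff_eq hp Nat.prime_three).mp h; omega
  have hcop : IsCoprime ((3 : ℤ) ^ e) ((p : ℤ) ^ (j + 1)) := by
    apply IsCoprime.pow
    rw [isCoprime_comm, hprime.coprime_iff_not_dvd]
    intro h; exact hn (h.trans (by norm_num))
  have dvd_iff : ∀ z : ℤ, (((3 ^ e * p ^ (j + 1) : ℕ) : ℕ) : ℤ) ∣ z ↔ (3 : ℤ) ^ e ∣ z ∧ (p : ℤ) ^ (j + 1) ∣ z := by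
    intro z; push_cast
    exact ⟨fun h => ⟨(dvd_mul_right _ _).trans h, (dvd_mul_left _ _).trans h⟩, fun h => hcop.mul_dvd h.1 h.2⟩
  have h3e : (3 : ℤ) ^ e ∣ 3 := by
    have := pow_dvd_pow (3 : ℤ) he; rwa [pow_one] at this
  -- two roots agree up to sign
  have uniq : ∀ s t : ℤ, (((3 ^ e * p ^ (j + 1) : ℕ) : ℕ) : ℤ) ∣ s ^ 2 - 6 →
      (((3 ^ e * p ^ (j + 1) : ℕ) : ℕ) : ℤ) ∣ t ^ 2 - 6 →
      (((3 ^ e * p ^ (j + 1) : ℕ) : ℕ) : ℤ) ∣ s - t ∨ (((3 ^ e * p ^ (j + 1) : ℕ) : ℕ) : ℤ) ∣ s + t := by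
    have h30 : ∀ s : ℤ, (3 : ℤ) ^ e ∣ s ^ 2 - 6 → (3 : ℤ) ^ e ∣ s := by
      intro s hs
      interval_cases e
      · simp
      · rw [pow_one] at hs ⊢
        have : (3 : ℤ) ∣ s ^ 2 := by omega
        exact Int.prime_three.dvd_of_dvd_pow this
    intro s t hs ht
    rw [dvd_iff] at hs ht ⊢
    rw [dvd_iff]
    have s3 := h30 s hs.1
    have t3 := h30 t ht.1
    have hmul : (p : ℤ) ^ (j + 1) ∣ (s - t) * (s + t) := by
      have := dvd_sub hs.2 ht.2
      rwa [show s ^ 2 - 6 - (t ^ 2 - 6) = (s - t) * (s + t) by ring] at this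
    by_cases hd : (p : ℤ) ∣ s - t
    · left
      refine ⟨dvd_sub s3 t3, ?_⟩
      have hnd : ¬ (p : ℤ) ∣ s + t := by
        intro hd'
        apply hn
        have a1 : (p : ℤ) ∣ s ^ 2 - 6 := (dvd_pow_self _ (by omega)).trans hs.2
        have a2 : (p : ℤ) ∣ ((s - t) + (s + t)) * s - 2 * (s ^ 2 - 6) :=
          dvd_sub (Dvd.dvd.mul_right (dvd_add hd hd') _) (Dvd.dvd.mul_left a1 _)
        rwa [show ((s - t) + (s + t)) * s - 2 * (s ^ 2 - 6) = 12 by ring] at a2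
      exact (IsCoprime.pow_left ((hprime.coprime_iff_not_dvd).mpr hnd)).dvd_of_dvd_mul_right hmul
    · right
      refine ⟨dvd_add s3 t3, ?_⟩
      exact (IsCoprime.pow_left ((hprime.coprime_iff_not_dvd).mpr hd)).dvd_of_dvd_mul_left hmul
  obtain ⟨t0, ht0⟩ := exists_root p hp h24 j
  -- a root modulo m
  obtain ⟨t, ht⟩ : ∃ t : ℤ, (((3 ^ e * p ^ (j + 1) : ℕ) : ℕ) : ℤ) ∣ t ^ 2 - 6 := by
    refine ⟨t0 * (1 - ((p : ℤ) ^ (j + 1)) ^ 2), ?_⟩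
    rw [dvd_iff]
    constructor
    · refine h3e.trans ?_
      have h3 : (3 : ℤ) ∣ 1 - ((p : ℤ) ^ (j + 1)) ^ 2 := by
        have n3 : ¬ (3 : ℤ) ∣ (p : ℤ) ^ (j + 1) := by
          intro h
          have := Int.prime_three.dvd_of_dvd_pow h
          omega
        generalize (p : ℤ) ^ (j + 1) = P at *
        have : P % 3 = 1 ∨ P % 3 = 2 := by omega
        have : P ^ 2 % 3 = 1 := by rcases this with h | h <;> simp [pow_two, Int.mul_emod, h]
        omega
      exact dvd_sub (dvd_pow (Dvd.dvd.mul_left h3 _) (by norm_num)) (by norm_num)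
    · have : (t0 * (1 - ((p : ℤ) ^ (j + 1)) ^ 2)) ^ 2 - 6 = (t0 ^ 2 - 6) +
        (p : ℤ) ^ (j + 1) * (t0 ^ 2 * (-2 * (p : ℤ) ^ (j + 1) + ((p : ℤ) ^ (j + 1)) ^ 3)) := by ring
      rw [this]
      exact dvd_add ht0 (dvd_mul_right _ _)
  have hone : (Dp (3 ^ e * p ^ (j + 1))).card = 1 := by
    rw [card_eq_one]
    obtain ⟨a, ha, hca⟩ := root_surj _ hm t ht
    refine ⟨a, ?_⟩
    rw [eq_singleton_iff_unique_mem]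
    refine ⟨ha, fun b hb => ?_⟩
    generalize 3 ^ e * p ^ (j + 1) = m at *
    -- integer root attached to b
    have hub := Dp_unit hb
    have hsb := Dp_sq hb
    have hua := Dp_unit ha
    obtain ⟨s, hs⟩ := ZMod.intCast_surjective ((b.1 : ZMod m) * (b.2 : ZMod m)⁻¹)
    rw [← hs] at hsb
    have hs6 : (m : ℤ) ∣ s ^ 2 - 6 := by
      rw [← ZMod.intCast_zmod_eq_zero_iff_dvd]; push_cast; rw [hsb]; ring
    have hst := uniq s t hs6 ht
    have hb1 : (b.1 : ZMod m) = s * b.2 := by rw [hs]; linear_combination -(b.1 : ZMod m) * hub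
    have cases : ((b.1 : ZMod m) * a.2 = a.1 * b.2) ∨ ((b.1 : ZMod m) * a.2 = -(a.1 * b.2)) := by
      simp only [← ZMod.intCast_zmod_eq_zero_iff_dvd, CC] at hst hca
      push_cast at hst hca
      rw [hb1]
      rcases hst with h1 | h1 <;> rcases hca with h2 | h2
      · left; linear_combination (a.2 * b.2 : ZMod m) * h1 - (b.2 : ZMod m) * h2
      · right; linear_combination (a.2 * b.2 : ZMod m) * h1 + (b.2 : ZMod m) * h2
      · right; linear_combination (a.2 * b.2 : ZMod m) * h1 + (b.2 : ZMod m) * h2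
      · left; linear_combination (a.2 * b.2 : ZMod m) * h1 - (b.2 : ZMod m) * h2
    rcases cases with h | h
    · apply Dp_inj m b a hb ha
      rw [← ZMod.intCast_zmod_eq_zero_iff_dvd]; push_cast
      linear_combination h
    · exfalso
      apply Dp_no m hm b a hb ha
      rw [← ZMod.intCast_zmod_eq_zero_iff_dvd]; push_cast
      linear_combination h
  rw [hone]; exact odd_one

end QS

namespace QS
open Finset

lemma hecke_card (n : ℕ) (hn : 0 < n) : (hecke n).card = (DD (8 * n - 1)).card := by
  have memH : ∀ r j, (r, j) ∈ hecke n ↔ j < 2 * (r + 1) ∧ n + j * (j + 1) / 2 = 3 * (r + 1) ^ 2 := by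
    intro r j
    rw [hecke, mem_filter, mem_product, mem_range, mem_range]
    refine ⟨fun h => h.2, fun h => ⟨?_, h⟩⟩
    obtain ⟨h1, h2⟩ := h
    simp only at h1 h2 ⊢
    have h3 : j * (j + 1) ≤ (2 * r + 1) * (2 * r + 2) := Nat.mul_le_mul (by omega) (by omega)
    have e1 : (2 * r + 1) * (2 * r + 2) = 4 * r ^ 2 + 6 * r + 2 := by ring
    have e2 : 3 * (r + 1) ^ 2 = 3 * r ^ 2 + 6 * r + 3 := by ring
    omega
  have even2 : ∀ j, 2 * (j * (j + 1) / 2) = j * (j + 1) := fun j =>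
    Nat.mul_div_cancel' (Nat.even_mul_succ_self j).two_dvd
  apply card_nbij' (fun p => (2 * p.2 + 1, 2 * (p.1 + 1))) (fun p => (p.2 / 2 - 1, p.1 / 2))
  · rintro ⟨r, j⟩ h
    rw [mem_coe, memH] at h
    rw [mem_coe, mem_DD]
    have e := even2 j
    refine ⟨by simp only; omega, ?_⟩
    simp only
    have e1 : (2 * j + 1) ^ 2 = 4 * (j * (j + 1)) + 1 := by ring
    have e2 : 6 * (2 * (r + 1)) ^ 2 = 8 * (3 * (r + 1) ^ 2) := by ring
    omega
  · rintro ⟨x, y⟩ h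
    rw [mem_coe, mem_DD] at h
    rw [mem_coe, memH]
    simp only at h ⊢
    obtain ⟨h1, h2⟩ := h
    have hx := @no_mod8_sq x
    have hy := @no_mod8_sq y
    have hx' : x ^ 2 % 8 = 0 ∨ x ^ 2 % 8 = 1 ∨ x ^ 2 % 8 = 4 := by
      rcases hx with hx | hx | hx <;> [left; (right; left); (right; right)] <;> exact_mod_cast hx
    have hy' : y ^ 2 % 8 = 0 ∨ y ^ 2 % 8 = 1 ∨ y ^ 2 % 8 = 4 := by
      rcases hy with hy | hy | hy <;> [left; (right; left); (right; right)] <;> exact_mod_cast hy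
    obtain ⟨j, rfl⟩ : ∃ j, x = 2 * j + 1 := by
      rcases Nat.even_or_odd' x with ⟨j, rfl | rfl⟩
      · have : (2 * j) ^ 2 = 4 * j ^ 2 := by ring
        omega
      · exact ⟨j, rfl⟩
    obtain ⟨z, rfl⟩ : ∃ z, y = 2 * z := by
      rcases Nat.even_or_odd' y with ⟨j, rfl | rfl⟩
      · exact ⟨j, rfl⟩
      · have : (2 * j + 1) ^ 2 = 4 * (j ^ 2 + j) + 1 := by ring
        omega
    obtain ⟨r, rfl⟩ : ∃ r, z = r + 1 := ⟨z - 1, by omega⟩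
    rw [show (2 * j + 1) / 2 = j by omega, show 2 * (r + 1) / 2 - 1 = r by omega]
    have e := even2 j
    have e1 : (2 * j + 1) ^ 2 = 4 * (j * (j + 1)) + 1 := by ring
    have e2 : 6 * (2 * (r + 1)) ^ 2 = 8 * (3 * (r + 1) ^ 2) := by ring
    exact ⟨by omega, by omega⟩
  · rintro ⟨r, j⟩ _
    simp only [Prod.mk.injEq]; omega
  · rintro ⟨x, y⟩ h
    rw [mem_coe, mem_DD] at h
    simp only at h
    obtain ⟨h1, h2⟩ := h
    have hx := @no_mod8_sq x
    have hy := @no_mod8_sq y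
    have hx' : x ^ 2 % 8 = 0 ∨ x ^ 2 % 8 = 1 ∨ x ^ 2 % 8 = 4 := by
      rcases hx with hx | hx | hx <;> [left; (right; left); (right; right)] <;> exact_mod_cast hx
    have hy' : y ^ 2 % 8 = 0 ∨ y ^ 2 % 8 = 1 ∨ y ^ 2 % 8 = 4 := by
      rcases hy with hy | hy | hy <;> [left; (right; left); (right; right)] <;> exact_mod_cast hy
    obtain ⟨j, rfl⟩ : ∃ j, x = 2 * j + 1 := by
      rcases Nat.even_or_odd' x with ⟨j, rfl | rfl⟩
      · have : (2 * j) ^ 2 = 4 * j ^ 2 := by ring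
        omega
      · exact ⟨j, rfl⟩
    obtain ⟨z, rfl⟩ : ∃ z, y = 2 * z := by
      rcases Nat.even_or_odd' y with ⟨j, rfl | rfl⟩
      · exact ⟨j, rfl⟩
      · have : (2 * j + 1) ^ 2 = 4 * (j ^ 2 + j) + 1 := by ring
        omega
    simp only [Prod.mk.injEq]; omega

lemma DD_card (m : ℕ) (hm : 0 < m) :
    (DD m).card = ∑ g ∈ (range (m + 1)).filter (fun g => g ^ 2 ∣ m), (Dp (m / g ^ 2)).card := by
  rw [card_eq_sum_card_fiberwise (f := fun p => Nat.gcd p.1 p.2) (t := (range (m + 1)).filter (fun g => g ^ 2 ∣ m))]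
  · apply sum_congr rfl
    intro g hg
    rw [mem_filter] at hg
    obtain ⟨_, a, ha⟩ := hg
    have hg0 : 0 < g := Nat.pos_of_ne_zero (by rintro rfl; simp at ha; omega)
    have hma : m / g ^ 2 = a := by rw [ha]; exact Nat.mul_div_cancel_left _ (by positivity)
    rw [hma]
    apply card_nbij' (fun p => (p.1 / g, p.2 / g)) (fun p => (g * p.1, g * p.2))
    · rintro ⟨x, y⟩ h
      rw [mem_coe, mem_filter, mem_DD] at h
      rw [mem_coe, mem_Dp]
      simp only at h ⊢
      obtain ⟨⟨h1, h2⟩, h3⟩ := h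
      obtain ⟨u, v, huv, hx, hy⟩ := Nat.exists_coprime x y
      rw [h3] at hx hy
      rw [hx, hy, Nat.mul_div_cancel _ hg0, Nat.mul_div_cancel _ hg0]
      refine ⟨⟨?_, ?_⟩, huv⟩
      · rw [hx, hy] at h1; nlinarith
      · rw [hx, hy, ha] at h2
        have : g ^ 2 * (u ^ 2 + a) = g ^ 2 * (6 * v ^ 2) := by rw [mul_pow, mul_pow] at h2; linarith
        exact Nat.eq_of_mul_eq_mul_left (by positivity) this
    · rintro ⟨x, y⟩ h
      rw [mem_coe, mem_Dp] at h
      rw [mem_coe, mem_filter, mem_DD]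
      simp only at h ⊢
      obtain ⟨⟨h1, h2⟩, h3⟩ := h
      refine ⟨⟨by nlinarith, ?_⟩, ?_⟩
      · rw [ha, mul_pow, mul_pow, ← mul_add, h2]; ring
      · rw [Nat.gcd_mul_left, h3, mul_one]
    · rintro ⟨x, y⟩ h
      rw [mem_coe, mem_filter] at h
      simp only at h ⊢
      have h1 : g ∣ x := h.2 ▸ Nat.gcd_dvd_left x y
      have h2 : g ∣ y := h.2 ▸ Nat.gcd_dvd_right x y
      rw [Nat.mul_div_cancel' h1, Nat.mul_div_cancel' h2]
    · rintro ⟨x, y⟩ _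
      simp only
      rw [Nat.mul_div_cancel_left _ hg0, Nat.mul_div_cancel_left _ hg0]
  · rintro ⟨x, y⟩ h
    rw [mem_coe, mem_DD] at h
    rw [mem_coe, mem_filter, mem_range]
    simp only at h ⊢
    have hd : Nat.gcd x y ^ 2 ∣ m := by
      have h1 : Nat.gcd x y ^ 2 ∣ x ^ 2 := pow_dvd_pow_of_dvd (Nat.gcd_dvd_left _ _) 2
      have h2 : Nat.gcd x y ^ 2 ∣ y ^ 2 := pow_dvd_pow_of_dvd (Nat.gcd_dvd_right _ _) 2
      rw [Nat.dvd_add_iff_right h1, h.2]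
      exact Dvd.dvd.mul_left h2 _
    have := Nat.le_of_dvd hm hd
    have := Nat.le_self_pow (n := 2) (by norm_num) (Nat.gcd x y)
    exact ⟨by omega, hd⟩

open Classical in
/-- The set of `g` with `m / g^2` good. -/
noncomputable def TT (m : ℕ) : Finset ℕ := (range (m + 1)).filter fun g => g ^ 2 ∣ m ∧ Good (m / g ^ 2)

lemma DD_parity (m : ℕ) (hm : m % 8 = 7) : Odd (DD m).card ↔ Odd (TT m).card := by
  classical
  rw [DD_card m (by omega), ← ZMod.natCast_eq_one_iff_odd, ← ZMod.natCast_eq_one_iff_odd]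
  have : ((∑ g ∈ (range (m + 1)).filter (fun g => g ^ 2 ∣ m), (Dp (m / g ^ 2)).card : ℕ) : ZMod 2) =
      ((TT m).card : ZMod 2) := by
    rw [TT, ← filter_filter, card_filter]
    push_cast
    apply sum_congr rfl
    intro g hg
    rw [mem_filter] at hg
    obtain ⟨_, a, ha⟩ := hg
    have hg0 : 0 < g := Nat.pos_of_ne_zero (by rintro rfl; simp at ha; omega)
    have hma : m / g ^ 2 = a := by rw [ha]; exact Nat.mul_div_cancel_left _ (by positivity)
    rw [hma]
    have ha7 : a % 8 = 7 := by
      have hx := @no_mod8_sq g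
      have hx' : g ^ 2 % 8 = 0 ∨ g ^ 2 % 8 = 1 ∨ g ^ 2 % 8 = 4 := by
        rcases hx with hx | hx | hx <;> [left; (right; left); (right; right)] <;> exact_mod_cast hx
      rw [ha, Nat.mul_mod] at hm
      rcases hx' with h | h | h <;> rw [h] at hm <;> omega
    by_cases hG : Good a
    · rw [if_pos hG, ZMod.natCast_eq_one_iff_odd]; exact Good_odd a ha7 hG
    · rw [if_neg hG, ZMod.natCast_eq_zero_iff_even]
      rw [← Nat.not_odd_iff_even]
      exact fun h => hG (odd_Good a ha7 h)
  rw [this]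

lemma TT_card (b c ℓ p : ℕ) (hp : p.Prime) (h24 : p % 24 = 5 ∨ p % 24 = 23) (hpl : ¬ p ∣ ℓ) (hl : 1 ≤ ℓ)
    (hc : c % 2 = 1) : (TT (3 ^ b * ℓ ^ 2 * p ^ c)).card = (c + 1) / 2 := by
  classical
  have hp0 : 0 < p := hp.pos
  have hm0 : 0 < 3 ^ b * ℓ ^ 2 * p ^ c := by positivity
  have hinj : Function.Injective fun i => 3 ^ (b / 2) * ℓ * p ^ i := by
    intro i j h
    simp only at h
    have := Nat.eq_of_mul_eq_mul_left (by positivity) h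
    exact Nat.pow_right_injective hp.two_le this
  have : TT (3 ^ b * ℓ ^ 2 * p ^ c) = (range ((c + 1) / 2)).image fun i => 3 ^ (b / 2) * ℓ * p ^ i := by
    ext g
    rw [TT, mem_filter, mem_image]
    constructor
    · rintro ⟨_, ⟨h, hh⟩, hG⟩
      have hg0 : 0 < g := Nat.pos_of_ne_zero (by rintro rfl; rw [hh] at hm0; simp at hm0)
      rw [hh, Nat.mul_div_cancel_left _ (by positivity)] at hG
      obtain ⟨r, k, e, hr, hr24, he, hk, rfl⟩ := hG
      have hr0 : 0 < r := hr.pos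
      have hval : ∀ s : ℕ, 2 * g.factorization s + (e * (Nat.factorization 3 s) + k * r.factorization s) =
          b * (Nat.factorization 3 s) + 2 * ℓ.factorization s + c * p.factorization s := by
        intro s
        have := congrArg (fun z => Nat.factorization z s) hh
        rw [Nat.factorization_mul (by positivity) (by positivity), Nat.factorization_mul (by positivity) (by positivity),
          Nat.factorization_mul (by positivity) (by positivity), Nat.factorization_mul (by positivity) (by positivity)] at this
        simp only [Nat.factorization_pow, Finsupp.add_apply, Finsupp.smul_apply, smul_eq_mul] at this
        omega
      simp only [Nat.prime_three.factorization, hr.factorization, hp.factorization, Finsupp.single_apply] at hval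
      have hrp : r = p := by
        by_contra hne
        have := hval r
        rw [if_neg (show ¬ 3 = r by omega), if_pos rfl, if_neg (fun h => hne h.symm)] at this
        omega
      subst hrp
      have v1 := hval r
      have v3 := hval 3
      rw [if_neg (show ¬ 3 = r by omega), if_pos rfl, Nat.factorization_eq_zero_of_not_dvd hpl] at v1
      rw [if_pos rfl, if_neg (show ¬ r = 3 by omega)] at v3
      have hbe : b = 2 * (b / 2) + e := by omega
      obtain ⟨i, a, hra, hgi⟩ := Nat.exists_eq_pow_mul_and_not_dvd (n := g) (by omega) r hr.ne_one
      have hi : g.factorization r = i := by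
        have ha0 : a ≠ 0 := by rintro rfl; simp at hra
        rw [hgi, Nat.factorization_mul (by positivity) ha0, Finsupp.add_apply, Nat.factorization_pow,
          Finsupp.smul_apply, hr.factorization, Nat.factorization_eq_zero_of_not_dvd hra]
        simp
      refine ⟨i, by rw [mem_range]; omega, ?_⟩
      have hci : c = 2 * i + k := by omega
      have hsq : (r ^ i * a) ^ 2 = (3 ^ (b / 2) * ℓ * r ^ i) ^ 2 := by
        rw [hci, hgi] at hh
        have e3 : 3 ^ b = (3 ^ (b / 2)) ^ 2 * 3 ^ e := by
          rw [← pow_mul, ← pow_add]; congr 1; omega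
        rw [e3] at hh
        have : (r ^ i * a) ^ 2 * (3 ^ e * r ^ k) = (3 ^ (b / 2) * ℓ * r ^ i) ^ 2 * (3 ^ e * r ^ k) := by
          rw [← hh]; ring
        exact Nat.eq_of_mul_eq_mul_right (by positivity) this
      rw [hgi]
      exact (Nat.pow_left_injective (show 2 ≠ 0 by norm_num) hsq).symm
    · rintro ⟨i, hi, rfl⟩
      rw [mem_range] at hi
      have e1 : 3 ^ b * ℓ ^ 2 * p ^ c = (3 ^ (b / 2) * ℓ * p ^ i) ^ 2 * (3 ^ (b % 2) * p ^ (c - 2 * i)) := by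
        have a1 : 3 ^ b = (3 ^ (b / 2)) ^ 2 * 3 ^ (b % 2) := by
          rw [← pow_mul, ← pow_add]; congr 1; omega
        have a2 : p ^ c = (p ^ i) ^ 2 * p ^ (c - 2 * i) := by
          rw [← pow_mul, ← pow_add]; congr 1; omega
        rw [a1, a2]; ring
      have hd : (3 ^ (b / 2) * ℓ * p ^ i) ^ 2 ∣ 3 ^ b * ℓ ^ 2 * p ^ c := ⟨_, e1⟩
      refine ⟨?_, hd, ?_⟩
      · rw [mem_range]
        have h1 := Nat.le_of_dvd hm0 hd
        have h2 := Nat.le_self_pow (n := 2) (by norm_num) (3 ^ (b / 2) * ℓ * p ^ i)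
        omega
      · rw [e1, Nat.mul_div_cancel_left _ (by positivity)]
        exact ⟨p, c - 2 * i, b % 2, hp, h24, by omega, by omega, rfl⟩
  rw [this, card_image_of_injective _ hinj, card_range]

lemma TT_odd (m : ℕ) (hm : 0 < m) : Odd (TT m).card ↔
    ∃ (b c : ℕ) (ℓ p : ℕ), p.Prime ∧ (p % 24 = 5 ∨ p % 24 = 23) ∧ ¬ p ∣ ℓ ∧ 1 ≤ ℓ ∧
        c % 4 = 1 ∧ m = 3 ^ b * ℓ ^ 2 * p ^ c := by
  classical
  constructor
  · intro h
    have hne : (TT m).Nonempty := by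
      rw [← card_pos]; rw [Nat.odd_iff] at h; omega
    obtain ⟨g, hg⟩ := hne
    rw [TT, mem_filter] at hg
    obtain ⟨_, ⟨a, ha⟩, p, k, e, hp, h24, he, hk, hG⟩ := hg
    have hg0 : 0 < g := Nat.pos_of_ne_zero (by rintro rfl; simp at ha; omega)
    rw [ha, Nat.mul_div_cancel_left _ (by positivity)] at hG
    obtain ⟨i, l, hpl, hgi⟩ := Nat.exists_eq_pow_mul_and_not_dvd (n := g) (by omega) p hp.ne_one
    have hl : 1 ≤ l := Nat.pos_of_ne_zero (by rintro rfl; simp at hpl)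
    have hm' : m = 3 ^ e * l ^ 2 * p ^ (2 * i + k) := by rw [ha, hG, hgi]; ring
    refine ⟨e, 2 * i + k, l, p, hp, h24, hpl, hl, ?_, hm'⟩
    rw [hm', TT_card e _ l p hp h24 hpl hl (by omega), Nat.odd_iff] at h
    omega
  · rintro ⟨b, c, l, p, hp, h24, hpl, hl, hc, rfl⟩
    rw [TT_card b c l p hp h24 hpl hl (by omega), Nat.odd_iff]
    omega

end QS

theorem stmt12 (u2 : ℕ → ℤ)
    (h : ∀ q : ℝ, 0 < q → q < 1 →
      HasSum (fun n => (u2 n : ℝ) * q ^ n) (U2series q)) (n : ℕ) :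
    Odd (u2 n) ↔
      ∃ (b c : ℕ) (ℓ p : ℕ), p.Prime ∧ (p % 24 = 5 ∨ p % 24 = 23) ∧ ¬ p ∣ ℓ ∧ 1 ≤ ℓ ∧
        c % 4 = 1 ∧ 8 * (n : ℤ) - 1 = 3 ^ b * (ℓ : ℤ) ^ 2 * (p : ℤ) ^ c := by
  rw [QS.u2_parity u2 h n]
  rcases Nat.eq_zero_or_pos n with rfl | hn
  · constructor
    · intro h; simp [QS.hecke] at h
    · rintro ⟨b, c, l, p, hp, -, -, -, -, he⟩
      have : (0 : ℤ) ≤ 3 ^ b * (l : ℤ) ^ 2 * (p : ℤ) ^ c := by positivity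
      rw [← he] at this
      simp at this
  · rw [QS.hecke_card n hn, QS.DD_parity _ (by omega), QS.TT_odd _ (by omega)]
    have e : ∀ b c l p : ℕ, (8 * n - 1 = 3 ^ b * l ^ 2 * p ^ c) ↔
        8 * (n : ℤ) - 1 = 3 ^ b * (l : ℤ) ^ 2 * (p : ℤ) ^ c := by
      intro b c l p
      rw [← Nat.cast_inj (R := ℤ), Nat.cast_sub (by omega)]
      push_cast
      rfl
    simp only [e]
end

section
/- For real $w > 0$, define $f(w) = (e^{-w}; e^{-w})_\infty = \prod_{n\geq 1}(1 - e^{-nw})$. Then $f(w) \sim \sqrt{2\pi/w}\, e^{-\pi^2/(6w)}$ as $w \to 0^+$, i.e., $\lim_{w\to 0^+} f(w)\, \sqrt{w/(2\pi)}\, e^{\pi^2/(6w)} = 1$. -/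
theorem norm_eta_imag (t : ℝ) (ht : 0 < t) :
    ‖ModularForm.eta (t * Complex.I)‖ = Real.exp (-(Real.pi * t / 12)) *
      ∏' n : ℕ, (1 - Real.exp (-((n : ℝ) + 1) * (2 * Real.pi * t))) := by
  have hz : ((t : ℂ) * Complex.I) ∈ UpperHalfPlane.upperHalfPlaneSet := by
    simpa [UpperHalfPlane.upperHalfPlaneSet] using ht
  rw [ModularForm.eta, norm_mul,
    (ModularForm.multipliableLocallyUniformlyOn_eta.multipliable hz).norm_tprod]
  congr 1
  · rw [Function.Periodic.qParam, Complex.norm_exp]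
    congr 1
    rw [show (2 * (Real.pi : ℂ) * Complex.I * (t * Complex.I) / ((24 : ℝ) : ℂ))
      = ((-(Real.pi * t / 12) : ℝ) : ℂ) by
        push_cast
        linear_combination (Real.pi * t / 12 : ℂ) * Complex.I_sq]
    simp
  · refine tprod_congr fun n => ?_
    rw [ModularForm.eta_q_eq_cexp,
      show (2 * (Real.pi : ℂ) * Complex.I * (n + 1) * (t * Complex.I))
      = ((-((n : ℝ) + 1) * (2 * Real.pi * t) : ℝ) : ℂ) by
        push_cast
        linear_combination (2 * Real.pi * (n + 1) * t : ℂ) * Complex.I_sq,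
      ← Complex.ofReal_exp, ← Complex.ofReal_one, ← Complex.ofReal_sub, Complex.norm_real,
      Real.norm_of_nonneg]
    rw [sub_nonneg, Real.exp_le_one_iff]
    have : 0 ≤ ((n : ℝ) + 1) * (2 * Real.pi * t) := by positivity
    linarith

theorem norm_eta_transform (t : ℝ) (ht : 0 < t) :
    ‖ModularForm.eta ((1 / t : ℝ) * Complex.I)‖ =
      Real.sqrt t * ‖ModularForm.eta (t * Complex.I)‖ := by
  have hz : ((t : ℂ) * Complex.I) ∈ UpperHalfPlane.upperHalfPlaneSet := by
    simpa [UpperHalfPlane.upperHalfPlaneSet] using ht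
  have hsq : ∀ z : ℂ, ‖Complex.sqrt z‖ = Real.sqrt ‖z‖ := by
    intro z
    rw [Complex.sqrt, Real.sqrt_eq_rpow, ← Complex.norm_cpow_real]
    norm_num
  have h := ModularForm.eta_comp_eq_csqrt_I_inv hz
  have ht0 : (t : ℂ) ≠ 0 := by exact_mod_cast ht.ne'
  have e : -1 / ((t : ℂ) * Complex.I) = (1 / t : ℝ) * Complex.I := by
    push_cast
    field_simp
    simp
  simp only [Function.comp_apply, Pi.smul_apply, Pi.mul_apply, smul_eq_mul, e] at h
  rw [h, norm_mul, norm_mul, norm_inv, hsq, hsq]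
  simp [abs_of_pos ht]

theorem tendsto_prod_one : Filter.Tendsto (fun q : ℝ ↦ ∏' (n : ℕ), (1 - q ^ (n + 1)))
    (nhds 0) (nhds 1) := by
  have := tendsto_tprod_one_add_of_dominated_convergence (𝓕 := nhds 0) (g := 0)
    (f := fun (q : ℝ) (n : ℕ) ↦ -q ^ (n + 1)) (bound := fun n ↦ (1 / 2 : ℝ) ^ (n + 1))
  simp only [Pi.zero_apply, norm_neg, norm_pow, add_zero, tprod_one] at this
  simp_rw [sub_eq_add_neg]
  refine this
    (by simpa only [pow_succ'] using (summable_geometric_of_abs_lt_one (by norm_num)).mul_left _)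
    (fun k ↦ by simpa using ((continuous_pow (M := ℝ) (k + 1)).tendsto 0).neg) ?_
  filter_upwards [Metric.ball_mem_nhds (0 : ℝ) (by norm_num : (0 : ℝ) < 1 / 2)] with q hq k
  exact pow_le_pow_left₀ (norm_nonneg _) (mem_ball_zero_iff.mp hq).le _

theorem stmt14 :
    Filter.Tendsto
      (fun w : ℝ =>
        (∏' n : ℕ, (1 - Real.exp (-((n : ℝ) + 1) * w))) * Real.sqrt (w / (2 * Real.pi)) *
          Real.exp (Real.pi ^ 2 / (6 * w)))
      (nhdsWithin 0 (Set.Ioi 0)) (nhds 1) := by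
  have hpi := Real.pi_pos
  have hq : Filter.Tendsto (fun w : ℝ => Real.exp (-(4 * Real.pi ^ 2 * w⁻¹)))
      (nhdsWithin 0 (Set.Ioi 0)) (nhds 0) :=
    Real.tendsto_exp_neg_atTop_nhds_zero.comp
      (Filter.Tendsto.const_mul_atTop (by positivity) tendsto_inv_nhdsGT_zero)
  have he : Filter.Tendsto (fun w : ℝ => Real.exp (w / 24))
      (nhdsWithin 0 (Set.Ioi 0)) (nhds 1) := by
    have : Continuous fun w : ℝ => Real.exp (w / 24) := by fun_prop
    simpa using (this.tendsto 0).mono_left nhdsWithin_le_nhds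
  have hl := he.mul (tendsto_prod_one.comp hq)
  rw [mul_one] at hl
  refine hl.congr' ?_
  filter_upwards [self_mem_nhdsWithin] with w hw
  have hw : 0 < w := hw
  have ht : 0 < w / (2 * Real.pi) := by positivity
  have h := norm_eta_transform _ ht
  rw [norm_eta_imag _ ht, norm_eta_imag _ (by positivity)] at h
  rw [show 2 * Real.pi * (w / (2 * Real.pi)) = w by field_simp,
    show Real.pi * (1 / (w / (2 * Real.pi))) / 12 = Real.pi ^ 2 / (6 * w) by field_simp; norm_num,
    show Real.pi * (w / (2 * Real.pi)) / 12 = w / 24 by field_simp; norm_num,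
    show 2 * Real.pi * (1 / (w / (2 * Real.pi))) = 4 * Real.pi ^ 2 * w⁻¹ by
      field_simp; norm_num, Real.exp_neg, Real.exp_neg] at h
  have e : ∏' n : ℕ, (1 - Real.exp (-(4 * Real.pi ^ 2 * w⁻¹)) ^ (n + 1)) =
      ∏' n : ℕ, (1 - Real.exp (-((n : ℝ) + 1) * (4 * Real.pi ^ 2 * w⁻¹))) := by
    refine tprod_congr fun n => ?_
    rw [← Real.exp_nat_mul]
    push_cast
    ring_nf
  simp only [Function.comp_apply]
  rw [e]
  have h1 := Real.exp_pos (w / 24)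
  have h2 := Real.exp_pos (Real.pi ^ 2 / (6 * w))
  generalize Real.exp (w / 24) = A at *
  generalize Real.exp (Real.pi ^ 2 / (6 * w)) = B at *
  generalize ∏' n : ℕ, (1 - Real.exp (-((n : ℝ) + 1) * (4 * Real.pi ^ 2 * w⁻¹))) = P at *
  generalize ∏' n : ℕ, (1 - Real.exp (-((n : ℝ) + 1) * w)) = Q at *
  generalize Real.sqrt (w / (2 * Real.pi)) = R at *
  field_simp at h
  linear_combination h
end

section
/- Define $\overline{u2}(n)$ by $\sum_{n\geq 0}\overline{u2}(n)q^n = \sum_{n\geq 1} \frac{((-q^2;q^2)_{n-1})^2\, q^{2n}}{(q;-q)_{2n}}$ (i.e., the coefficients of $\overline{U2}(1;-q)$). Then $\overline{u2}(n+1) \geq \overline{u2}(n)$ for all $n \geq 0$. -/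
/-- The series `U2bar(1;-q) = ∑_{n≥1} (-q²;q²)_{n-1}² q^{2n} / (q;-q)_{2n}`. -/
noncomputable def U2barSeries (q : ℝ) : ℝ :=
  ∑' n : ℕ, (∏ j ∈ Finset.range n, (1 + q ^ 2 * (q ^ 2) ^ j)) ^ 2 * q ^ (2 * (n + 1)) /
    ∏ j ∈ Finset.range (2 * (n + 1)), (1 - q * (-q) ^ j)

lemma HasSum.congr_pt {f g : ℕ → ℝ} {a : ℝ} (h : HasSum f a) (e : ∀ n, g n = f n) :
    HasSum g a := by
  rw [show g = f from funext e]
  exact h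

/-- `f` is represented on `(0,1)` by a power series with nonnegative coefficients. -/
def NP (f : ℝ → ℝ) : Prop :=
  ∃ c : ℕ → ℝ, (∀ n, 0 ≤ c n) ∧ ∀ q : ℝ, 0 < q → q < 1 → HasSum (fun n => c n * q ^ n) (f q)

lemma NP.congr {f g : ℝ → ℝ} (hf : NP f) (h : ∀ q : ℝ, 0 < q → q < 1 → g q = f q) : NP g := by
  obtain ⟨c, h0, hc⟩ := hf
  exact ⟨c, h0, fun q h1 h2 => by rw [h q h1 h2]; exact hc q h1 h2⟩

lemma NP.add {f g : ℝ → ℝ} (hf : NP f) (hg : NP g) : NP (fun q => f q + g q) := by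
  obtain ⟨c, h0, hc⟩ := hf
  obtain ⟨d, k0, hd⟩ := hg
  refine ⟨fun n => c n + d n, fun n => add_nonneg (h0 n) (k0 n), fun q h1 h2 => ?_⟩
  simpa only [add_mul] using (hc q h1 h2).add (hd q h1 h2)

lemma NP.mul {f g : ℝ → ℝ} (hf : NP f) (hg : NP g) : NP (fun q => f q * g q) := by
  obtain ⟨c, h0, hc⟩ := hf
  obtain ⟨d, k0, hd⟩ := hg
  refine ⟨fun n => ∑ kl ∈ Finset.HasAntidiagonal.antidiagonal n, c kl.1 * d kl.2,
    fun n => Finset.sum_nonneg fun kl _ => mul_nonneg (h0 _) (k0 _), fun q h1 h2 => ?_⟩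
  have e1 := (hc q h1 h2).summable.norm
  have e2 := (hd q h1 h2).summable.norm
  have e3 := (summable_norm_sum_mul_antidiagonal_of_summable_norm e1 e2).of_norm.hasSum
  rw [← tsum_mul_tsum_eq_tsum_sum_antidiagonal_of_summable_norm e1 e2, (hc q h1 h2).tsum_eq,
    (hd q h1 h2).tsum_eq] at e3
  refine HasSum.congr_pt e3 fun n => ?_
  dsimp only
  rw [Finset.sum_mul]
  refine Finset.sum_congr rfl fun kl hkl => ?_
  rw [← Finset.HasAntidiagonal.mem_antidiagonal.1 hkl, pow_add]
  ring

lemma NP.const_mul_pow {a : ℝ} (ha : 0 ≤ a) (k : ℕ) : NP (fun q => a * q ^ k) := by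
  refine ⟨fun n => if n = k then a else 0, fun n => by positivity, fun q _ _ => ?_⟩
  have := hasSum_ite_eq k (a * q ^ k)
  convert this using 2 with n
  split_ifs with h <;> simp [h]

lemma NP.pow (k : ℕ) : NP (fun q => q ^ k) :=
  (NP.const_mul_pow zero_le_one k).congr fun q _ _ => by ring

lemma NP.one : NP (fun _ => 1) := (NP.pow 0).congr fun q _ _ => by simp

lemma NP.geom {k : ℕ} (hk : 0 < k) : NP (fun q => 1 / (1 - q ^ k)) := by
  refine ⟨fun n => if k ∣ n then 1 else 0, fun n => by positivity, fun q h1 h2 => ?_⟩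
  have e := hasSum_geometric_of_lt_one (pow_nonneg h1.le k) (pow_lt_one₀ h1.le h2 hk.ne')
  have inj : Function.Injective (fun m : ℕ => k * m) := fun a b hab =>
    Nat.eq_of_mul_eq_mul_left hk hab
  dsimp only
  rw [one_div, ← inj.hasSum_iff]
  · convert e using 2 with n
    simp [pow_mul]
  · intro x hx
    have : ¬ k ∣ x := fun ⟨m, hm⟩ => hx ⟨m, hm.symm⟩
    simp [this]

lemma NP.onePlus (k : ℕ) : NP (fun q => 1 + q ^ k) := NP.one.add (NP.pow k)

lemma NP.prod {F : ℕ → ℝ → ℝ} (hF : ∀ j, NP (F j)) (n : ℕ) :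
    NP (fun q => ∏ j ∈ Finset.range n, F j q) := by
  induction n with
  | zero => simpa using NP.one
  | succ n ih => simpa only [Finset.prod_range_succ] using ih.mul (hF n)

lemma NP.tsum {F : ℕ → ℝ → ℝ} (hF : ∀ j, NP (F j))
    (hs : ∀ q : ℝ, 0 < q → q < 1 → Summable (fun j => F j q)) :
    NP (fun q => ∑' j, F j q) := by
  choose c h0 hc using hF
  have key : ∀ q : ℝ, 0 < q → q < 1 → Summable (fun p : ℕ × ℕ => c p.1 p.2 * q ^ p.2) := by
    intro q h1 h2
    rw [summable_prod_of_nonneg (fun p => mul_nonneg (h0 _ _) (pow_nonneg h1.le _))]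
    refine ⟨fun j => (hc j q h1 h2).summable, ?_⟩
    simpa only [(hc _ q h1 h2).tsum_eq] using hs q h1 h2
  refine ⟨fun n => ∑' j, c j n, fun n => tsum_nonneg fun j => h0 j n, fun q h1 h2 => ?_⟩
  have k := key q h1 h2
  have e := k.tsum_comm' (fun j => (hc j q h1 h2).summable) (fun n => k.prod_symm.prod_factor n)
  simp only [(hc _ q h1 h2).tsum_eq] at e
  have s := k.prod_symm.prod.hasSum
  simp only [Prod.swap_prod_mk] at s
  simp only [tsum_mul_right] at e s
  rw [e] at s
  exact s

lemma coeff_zero_of_hasSum {a : ℕ → ℝ}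
    (h : ∀ q : ℝ, 0 < q → q < 1 → HasSum (fun n => a n * q ^ n) 0) : a 0 = 0 := by
  have hs := (h (1 / 2) (by norm_num) (by norm_num)).summable.norm
  have := tendsto_tsum_of_dominated_convergence (𝓕 := nhdsWithin (0 : ℝ) (Set.Ioi 0))
    (f := fun q n => a n * q ^ n) (g := fun n => a n * 0 ^ n) hs
    (fun n => by
      have : Continuous fun q : ℝ => a n * q ^ n := by fun_prop
      exact (this.tendsto 0).mono_left nhdsWithin_le_nhds)
    (by
      filter_upwards [Ioo_mem_nhdsGT (show (0 : ℝ) < 1 / 2 by norm_num)] with q hq n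
      rw [norm_mul, norm_mul, norm_pow, norm_pow]
      gcongr
      rw [Real.norm_of_nonneg hq.1.le, Real.norm_of_nonneg (by norm_num)]
      exact hq.2.le)
  have e : (∑' n, a n * (0 : ℝ) ^ n) = a 0 := by
    rw [tsum_eq_single 0]
    · simp
    · intro n hn; simp [hn]
  rw [e] at this
  refine tendsto_nhds_unique this (tendsto_const_nhds.congr' ?_)
  filter_upwards [Ioo_mem_nhdsGT (show (0 : ℝ) < 1 by norm_num)] with q hq
  exact (h q hq.1 hq.2).tsum_eq.symm

lemma coeff_eq_zero_of_hasSum (n : ℕ) : ∀ {a : ℕ → ℝ},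
    (∀ q : ℝ, 0 < q → q < 1 → HasSum (fun n => a n * q ^ n) 0) → a n = 0 := by
  induction n with
  | zero => exact coeff_zero_of_hasSum
  | succ n ih =>
    intro a h
    refine ih (a := fun n => a (n + 1)) fun q h1 h2 => ?_
    have h0 := coeff_zero_of_hasSum h
    have e := (hasSum_nat_add_iff' 1).2 (h q h1 h2)
    simp only [Finset.range_one, Finset.sum_singleton, h0, zero_mul, sub_zero] at e
    have e' := e.mul_right q⁻¹
    rw [zero_mul] at e'
    refine HasSum.congr_pt e' fun m => ?_
    rw [pow_succ]
    field_simp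

lemma mono_of_NP {u : ℕ → ℝ} {s : ℝ → ℝ}
    (h : ∀ q : ℝ, 0 < q → q < 1 → HasSum (fun n => u n * q ^ n) (s q))
    (hN : NP (fun q => (1 - q) * s q)) (n : ℕ) : u n ≤ u (n + 1) := by
  obtain ⟨c, h0, hc⟩ := hN
  let d : ℕ → ℝ := fun n => u n - (match n with | 0 => 0 | m + 1 => u m)
  have hd : ∀ q : ℝ, 0 < q → q < 1 → HasSum (fun n => d n * q ^ n) ((1 - q) * s q) := by
    intro q h1 h2
    have e2 : HasSum (fun n => (match n with | 0 => 0 | m + 1 => u m : ℝ) * q ^ n) (q * s q) := by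
      rw [← hasSum_nat_add_iff' 1]
      simp only [Finset.range_one, Finset.sum_singleton, zero_mul, sub_zero]
      refine HasSum.congr_pt ((h q h1 h2).mul_left q) fun m => ?_
      ring
    rw [show (1 - q) * s q = s q - q * s q by ring]
    refine HasSum.congr_pt ((h q h1 h2).sub e2) fun m => ?_
    simp only [d]
    ring
  have := coeff_eq_zero_of_hasSum (n + 1) (a := fun n => d n - c n) fun q h1 h2 => by
    simpa only [sub_mul, sub_self] using (hd q h1 h2).sub (hc q h1 h2)
  have h3 := h0 (n + 1)
  simp only [d] at this
  linarith

lemma pos_one_sub {q : ℝ} (h1 : 0 < q) (h2 : q < 1) {k : ℕ} (hk : 0 < k) : 0 < 1 - q ^ k :=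
  sub_pos.2 (pow_lt_one₀ h1.le h2 hk.ne')

lemma denom_split (q : ℝ) (m : ℕ) : ∏ j ∈ Finset.range (2 * m), (1 - q * (-q) ^ j) =
    (∏ j ∈ Finset.range m, (1 - q ^ (2 * j + 1))) * ∏ j ∈ Finset.range m, (1 + q ^ (2 * j + 2)) := by
  induction m with
  | zero => simp
  | succ m ih =>
    rw [show 2 * (m + 1) = 2 * m + 1 + 1 by ring, Finset.prod_range_succ, Finset.prod_range_succ, ih,
      Finset.prod_range_succ, Finset.prod_range_succ, pow_succ (-q), pow_mul (-q), neg_sq]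
    ring

/-- The terms after multiplication by `1 - q`. -/
noncomputable def TT (n : ℕ) (q : ℝ) : ℝ :=
  (∏ j ∈ Finset.range n, (1 + q ^ (2 * j + 2))) * q ^ (2 * n + 2) /
    ((∏ j ∈ Finset.range n, (1 - q ^ (2 * j + 3))) * (1 + q ^ (2 * n + 2)))

lemma term_eq {q : ℝ} (h1 : 0 < q) (h2 : q < 1) (n : ℕ) :
    (1 - q) * ((∏ j ∈ Finset.range n, (1 + q ^ 2 * (q ^ 2) ^ j)) ^ 2 * q ^ (2 * (n + 1)) /
    ∏ j ∈ Finset.range (2 * (n + 1)), (1 - q * (-q) ^ j)) = TT n q := by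
  have e : ∀ j : ℕ, q ^ 2 * (q ^ 2) ^ j = q ^ (2 * j + 2) := fun j => by rw [← pow_mul]; ring
  rw [denom_split, Finset.prod_range_succ', Finset.prod_range_succ (fun j => 1 + q ^ (2 * j + 2))]
  simp only [e, TT]
  have a1 : (∏ j ∈ Finset.range n, (1 + q ^ (2 * j + 2))) ≠ 0 :=
    (Finset.prod_pos fun j _ => by positivity).ne'
  have a2 : (∏ j ∈ Finset.range n, (1 - q ^ (2 * j + 3))) ≠ 0 :=
    (Finset.prod_pos fun j _ => pos_one_sub h1 h2 (by omega)).ne'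
  have a3 : 1 - q ≠ 0 := (sub_pos.2 h2).ne'
  have a4 : 1 + q ^ (2 * n + 2) ≠ 0 := by positivity
  have e2 : ∀ j : ℕ, 2 * (j + 1) + 1 = 2 * j + 3 := fun j => by ring
  simp only [e2, mul_zero, zero_add, pow_one]
  rw [show 2 * (n + 1) = 2 * n + 2 by ring]
  field_simp

lemma TT_pos {q : ℝ} (h1 : 0 < q) (h2 : q < 1) (n : ℕ) : 0 < TT n q := by
  have a1 : 0 < (∏ j ∈ Finset.range n, (1 + q ^ (2 * j + 2))) :=
    (Finset.prod_pos fun j _ => by positivity)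
  have a2 : 0 < (∏ j ∈ Finset.range n, (1 - q ^ (2 * j + 3))) :=
    (Finset.prod_pos fun j _ => pos_one_sub h1 h2 (by omega))
  unfold TT
  positivity

lemma TT_succ {q : ℝ} (h1 : 0 < q) (h2 : q < 1) (n : ℕ) : TT (n + 1) q / TT n q =
    (1 + q ^ (2 * n + 2)) ^ 2 * q ^ 2 / ((1 - q ^ (2 * n + 3)) * (1 + q ^ (2 * n + 4))) := by
  have a1 : (∏ j ∈ Finset.range n, (1 + q ^ (2 * j + 2))) ≠ 0 :=
    (Finset.prod_pos fun j _ => by positivity).ne'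
  have a2 : (∏ j ∈ Finset.range n, (1 - q ^ (2 * j + 3))) ≠ 0 :=
    (Finset.prod_pos fun j _ => pos_one_sub h1 h2 (by omega)).ne'
  have a3 : 1 - q ^ (2 * n + 3) ≠ 0 := (pos_one_sub h1 h2 (by omega)).ne'
  have a4 : 1 + q ^ (2 * n + 2) ≠ 0 := by positivity
  have a5 : 1 + q ^ (2 * n + 4) ≠ 0 := by positivity
  unfold TT
  rw [Finset.prod_range_succ, Finset.prod_range_succ, show 2 * (n + 1) + 2 = 2 * n + 4 by ring]
  rw [div_div_div_eq, div_eq_div_iff (by simp [a1, a2, a3, a4, a5, h1.ne'])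
    (by simp [a3, a5])]
  ring

lemma TT_summable {q : ℝ} (h1 : 0 < q) (h2 : q < 1) : Summable (fun n => TT n q) := by
  refine summable_of_ratio_test_tendsto_lt_one (l := q ^ 2) (by nlinarith)
    (Filter.Eventually.of_forall fun n => (TT_pos h1 h2 n).ne') ?_
  have lim : ∀ i : ℕ, Filter.Tendsto (fun n : ℕ => q ^ (2 * n + i)) Filter.atTop (nhds 0) := by
    intro i
    refine (tendsto_pow_atTop_nhds_zero_of_lt_one h1.le h2).comp ?_
    exact Filter.tendsto_atTop_mono (fun n => by simp only [id]; omega) Filter.tendsto_id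
  have L : Filter.Tendsto (fun n : ℕ => (1 + q ^ (2 * n + 2)) ^ 2 * q ^ 2 /
      ((1 - q ^ (2 * n + 3)) * (1 + q ^ (2 * n + 4)))) Filter.atTop
      (nhds ((1 + 0) ^ 2 * q ^ 2 / ((1 - 0) * (1 + 0)))) :=
    ((((lim 2).const_add 1).pow 2).mul_const _).div
      (((lim 3).const_sub 1).mul ((lim 4).const_add 1)) (by norm_num)
  have e : ((1 + 0 : ℝ) ^ 2 * q ^ 2 / ((1 - 0) * (1 + 0))) = q ^ 2 := by norm_num
  rw [e] at L
  refine L.congr fun n => ?_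
  rw [← TT_succ h1 h2, Real.norm_of_nonneg (TT_pos h1 h2 _).le, Real.norm_of_nonneg (TT_pos h1 h2 _).le]

/-- Explicit positive form of the late terms. -/
lemma TT_late {q : ℝ} (h1 : 0 < q) (h2 : q < 1) (k : ℕ) : TT (k + 3) q =
    q ^ (2 * k + 8) * ((∏ j ∈ Finset.range (k + 3), (1 + q ^ (2 * j + 2))) *
      ((1 / (1 - q ^ (2 * k + 5)) + q ^ 3 * (1 / (1 - q ^ 3))) *
        ((∏ j ∈ Finset.range k, 1 / (1 - q ^ (2 * j + 5))) *
          (1 / (1 - q ^ (2 * k + 7)) * (1 / (1 - q ^ (4 * k + 16))))))) := by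
  unfold TT
  rw [Finset.prod_range_succ (fun j => 1 - q ^ (2 * j + 3)) (k + 2),
    Finset.prod_range_succ (fun j => 1 - q ^ (2 * j + 3)) (k + 1),
    Finset.prod_range_succ' (fun j => 1 - q ^ (2 * j + 3)) k, Finset.prod_div_distrib,
    Finset.prod_const_one]
  have e2 : ∀ j : ℕ, 2 * (j + 1) + 3 = 2 * j + 5 := fun j => by ring
  simp only [e2, mul_zero, zero_add]
  rw [show 2 * (k + 3) + 2 = 2 * k + 8 by ring, show 2 * (k + 1) + 5 = 2 * k + 7 by ring,
    show 4 * k + 16 = 2 * (2 * k + 8) by ring, pow_mul' q 2 (2 * k + 8)]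
  have a2 : (∏ j ∈ Finset.range k, (1 - q ^ (2 * j + 5))) ≠ 0 :=
    (Finset.prod_pos fun j _ => pos_one_sub h1 h2 (by omega)).ne'
  have a3 : 1 - q ^ 3 ≠ 0 := (pos_one_sub h1 h2 (by omega)).ne'
  have a5 : 1 - q ^ (2 * k + 5) ≠ 0 := (pos_one_sub h1 h2 (by omega)).ne'
  have a7 : 1 - q ^ (2 * k + 7) ≠ 0 := (pos_one_sub h1 h2 (by omega)).ne'
  have a8 : 1 - q ^ (2 * k + 8) ≠ 0 := (pos_one_sub h1 h2 (by omega)).ne'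
  have a9 : 1 + q ^ (2 * k + 8) ≠ 0 := by positivity
  have e8 : q ^ (2 * k + 8) = q ^ (2 * k + 5) * q ^ 3 := by rw [← pow_add]
  have e1 : 1 / (1 - q ^ (2 * k + 5)) + q ^ 3 * (1 / (1 - q ^ 3)) =
      (1 - q ^ (2 * k + 8)) / ((1 - q ^ (2 * k + 5)) * (1 - q ^ 3)) := by
    rw [e8]; field_simp; ring
  have e9 : 1 - (q ^ (2 * k + 8)) ^ 2 = (1 - q ^ (2 * k + 8)) * (1 + q ^ (2 * k + 8)) := by ring
  rw [e1, e9]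
  generalize (∏ j ∈ Finset.range k, (1 - q ^ (2 * j + 5))) = A at *
  generalize (∏ j ∈ Finset.range (k + 3), (1 + q ^ (2 * j + 2))) = B at *
  generalize q ^ (2 * k + 8) = x at *
  generalize q ^ (2 * k + 7) = y at *
  generalize q ^ (2 * k + 5) = z at *
  generalize q ^ 3 = w at *
  field_simp

lemma TT_late_NP (k : ℕ) : NP (TT (k + 3)) := by
  refine NP.congr ?_ fun q h1 h2 => TT_late h1 h2 k
  exact (NP.pow _).mul ((NP.prod (fun j => NP.onePlus _) _).mul
    (((NP.geom (by omega)).add ((NP.pow 3).mul (NP.geom (by omega)))).mul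
      ((NP.prod (fun j => NP.geom (by omega)) _).mul
        ((NP.geom (by omega)).mul (NP.geom (by omega))))))

lemma NP.mul1 {f g : ℝ → ℝ} (hf : NP (fun q => f q - 1)) (hg : NP (fun q => g q - 1)) :
    NP (fun q => f q * g q - 1) :=
  (((hf.mul hg).add hf).add hg).congr fun q _ _ => by ring

lemma NP.geom1 {k : ℕ} (hk : 0 < k) : NP (fun q => 1 / (1 - q ^ k) - 1) :=
  ((NP.pow k).mul (NP.geom hk)).congr fun q h1 h2 => by
    have := (pos_one_sub h1 h2 hk).ne'
    field_simp
    ring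

lemma NP.onePlus1 (k : ℕ) : NP (fun q => 1 + q ^ k - 1) :=
  (NP.pow k).congr fun q _ _ => by ring

lemma TT_three_NP : NP (fun q => TT 3 q - q ^ 8) := by
  have key : NP (fun q => ((1 + q ^ 2) * ((1 + q ^ 4) * (1 + q ^ 6))) *
      ((1 / (1 - q ^ 5) + q ^ 3 * (1 / (1 - q ^ 3))) *
          (1 / (1 - q ^ 7) * (1 / (1 - q ^ 16)))) - 1) := by
    refine NP.mul1 (NP.mul1 (NP.onePlus1 2) (NP.mul1 (NP.onePlus1 4) (NP.onePlus1 6)))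
      (NP.mul1 ?_ (NP.mul1 (NP.geom1 (by omega)) (NP.geom1 (by omega))))
    exact ((NP.geom1 (k := 5) (by omega)).add ((NP.pow 3).mul (NP.geom (k := 3) (by omega)))).congr
      fun q _ _ => by ring
  refine ((NP.pow 8).mul key).congr fun q h1 h2 => ?_
  rw [TT_late h1 h2 0]
  simp only [Finset.prod_range_succ, Finset.prod_range_zero]
  norm_num
  ring

/-- Explicit positive form of the first three terms. -/
lemma TT_early {q : ℝ} (h1 : 0 < q) (h2 : q < 1) : TT 0 q + TT 1 q + TT 2 q + q ^ 8 =
    ((1 * q ^ 2 + 3 * q ^ 6 + 1 * q ^ 7 + 2 * q ^ 9 + 2 * q ^ 10 + 1 * q ^ 11 + 2 * q ^ 12 +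
      2 * q ^ 13 + 2 * q ^ 14 + 4 * q ^ 15 + 1 * q ^ 17 + 5 * q ^ 18 + 3 * q ^ 20 + 4 * q ^ 21 +
      3 * q ^ 22 + 5 * q ^ 23 + 1 * q ^ 24 + 4 * q ^ 25 + 3 * q ^ 26 + 3 * q ^ 27 + 4 * q ^ 28 +
      2 * q ^ 29 + 4 * q ^ 30 + 3 * q ^ 31 + 2 * q ^ 32) +
      (4 * q ^ 33 + 2 * q ^ 34 + 4 * q ^ 35 + 3 * q ^ 36 + 3 * q ^ 37) * (1 / (1 - q ^ 5))) *
      (1 / (1 - q ^ 24)) := by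
  have a3 : 1 - q ^ 3 ≠ 0 := (pos_one_sub h1 h2 (by omega)).ne'
  have a5 : 1 - q ^ 5 ≠ 0 := (pos_one_sub h1 h2 (by omega)).ne'
  have a24 : 1 - q ^ 24 ≠ 0 := (pos_one_sub h1 h2 (by omega)).ne'
  have b2 : 1 + q ^ 2 ≠ 0 := by positivity
  have b4 : 1 + q ^ 4 ≠ 0 := by positivity
  have b6 : 1 + q ^ 6 ≠ 0 := by positivity
  simp only [TT, Finset.prod_range_succ, Finset.prod_range_zero, mul_zero, mul_one, zero_add,
    one_mul, Nat.reduceMul, Nat.reduceAdd]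
  rw [div_add_div _ _ b2 (mul_ne_zero a3 b4), div_add_div _ _ (by positivity)
    (mul_ne_zero (mul_ne_zero a3 a5) b6), div_add' _ _ _ (by positivity), mul_one_div, mul_one_div,
    add_div' _ _ _ a5, div_div, div_eq_div_iff (by positivity) (by positivity)]
  ring

lemma TT_early_NP : NP (fun q => TT 0 q + TT 1 q + TT 2 q + q ^ 8) := by
  refine NP.congr ?_ fun q h1 h2 => TT_early h1 h2
  refine NP.mul (NP.add ?_ (NP.mul ?_ (NP.geom (by omega)))) (NP.geom (by omega))
  all_goals
    repeat' first
      | exact NP.const_mul_pow (by norm_num) _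
      | apply NP.add

theorem stmt17 (u2bar : ℕ → ℝ)
    (h : ∀ q : ℝ, 0 < q → q < 1 → HasSum (fun n => u2bar n * q ^ n) (U2barSeries q)) :
    ∀ n : ℕ, u2bar n ≤ u2bar (n + 1) := by
  refine mono_of_NP h ?_
  have hs : ∀ q : ℝ, 0 < q → q < 1 → Summable (fun k => TT (k + 1 + 3) q) := fun q h1 h2 =>
    (summable_nat_add_iff 4).2 (TT_summable h1 h2)
  refine ((TT_early_NP.add TT_three_NP).add
    (NP.tsum (fun k => TT_late_NP (k + 1)) hs)).congr fun q h1 h2 => ?_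
  unfold U2barSeries
  rw [← tsum_mul_left]
  simp only [term_eq h1 h2]
  rw [← (TT_summable h1 h2).sum_add_tsum_nat_add 4]
  simp only [Finset.sum_range_succ, Finset.sum_range_zero, add_assoc, Nat.reduceAdd]
  ring
end
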